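/- arXiv:2106.13968 — 4 statements merged into one kernel-verified Lean document; each statement's English description precedes it below -/
import Mathlib

section
/- For all positive integers k, ℓ, m with k + ℓ + m ≤ n, the expectation of X(k,ℓ,m) under G(n,p) is at most e^{f(k,ℓ,m) + g(k,ℓ,m)}, where f(k,ℓ,m) = k·ln(n/k) + ℓ·ln(n/ℓ) + m·ln(n/m) + ln(kℓm) + k + ℓ + m − n·((1−p)^k + (1−p)^ℓ + (1−p)^m) + (kℓ + km + ℓm − 3)·ln(1−p) + 3·ln p and g(k,ℓ,m) = (k + ℓ + m)·((1−p)^k + (1−p)^ℓ + (1−p)^m). -/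
open MeasureTheory Filter Real

noncomputable instance simpleGraphMeasurableSpace {n : ℕ} :
    MeasurableSpace (SimpleGraph (Fin n)) := ⊤

/-- The binomial random graph `G(n,p)`: the measure on simple graphs on `Fin n`
assigning to each graph `G` the probability `p^{e(G)} * (1-p)^{n(n-1)/2 - e(G)}`. -/
noncomputable def gnp (n : ℕ) (p : ℝ) : Measure (SimpleGraph (Fin n)) :=
  Measure.sum fun G : SimpleGraph (Fin n) =>
    ENNReal.ofReal (p ^ Nat.card G.edgeSet *
      (1 - p) ^ (n * (n - 1) / 2 - Nat.card G.edgeSet)) • Measure.dirac G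

/-- The tuple `(X₁,x₁,X₂,x₂,X₃,x₃)` is special: the `Xᵢ` are pairwise disjoint, `xᵢ ∈ Xᵢ`,
every vertex outside `X₁ ∪ X₂ ∪ X₃` has a neighbor in each `Xᵢ`, and for distinct `i,j`
the only edge between `Xᵢ` and `Xⱼ` is `{xᵢ, xⱼ}`. -/
def SpecialTuple {n : ℕ} (G : SimpleGraph (Fin n)) (X₁ X₂ X₃ : Finset (Fin n))
    (x₁ x₂ x₃ : Fin n) : Prop :=
  Disjoint X₁ X₂ ∧ Disjoint X₁ X₃ ∧ Disjoint X₂ X₃ ∧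
  x₁ ∈ X₁ ∧ x₂ ∈ X₂ ∧ x₃ ∈ X₃ ∧
  (∀ v : Fin n, v ∉ X₁ → v ∉ X₂ → v ∉ X₃ →
    (∃ u ∈ X₁, G.Adj v u) ∧ (∃ u ∈ X₂, G.Adj v u) ∧ (∃ u ∈ X₃, G.Adj v u)) ∧
  (∀ u ∈ X₁, ∀ v ∈ X₂, (G.Adj u v ↔ u = x₁ ∧ v = x₂)) ∧
  (∀ u ∈ X₁, ∀ v ∈ X₃, (G.Adj u v ↔ u = x₁ ∧ v = x₃)) ∧
  (∀ u ∈ X₂, ∀ v ∈ X₃, (G.Adj u v ↔ u = x₂ ∧ v = x₃))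

/-- `X(k,ℓ,m)`: the number of special tuples `(X₁,x₁,X₂,x₂,X₃,x₃)` with
`|X₁| = k`, `|X₂| = ℓ`, `|X₃| = m`. -/
noncomputable def countX {n : ℕ} (G : SimpleGraph (Fin n)) (k l m : ℕ) : ℕ :=
  Nat.card {t : Finset (Fin n) × Finset (Fin n) × Finset (Fin n) × Fin n × Fin n × Fin n //
    t.1.card = k ∧ t.2.1.card = l ∧ t.2.2.1.card = m ∧
    SpecialTuple G t.1 t.2.1 t.2.2.1 t.2.2.2.1 t.2.2.2.2.1 t.2.2.2.2.2}

/-- The expectation of `X(k,ℓ,m)` under `G(n,p)`. -/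
noncomputable def expX (n : ℕ) (p : ℝ) (k l m : ℕ) : ℝ :=
  ∫ G, (countX G k l m : ℝ) ∂ gnp n p

/-- Expected product, over a disjoint family of blocks `S i`, of the indicators that a random
subset of `U` meets the block, for an unnormalised product weight on the subsets of `U`. -/
theorem sum_powerset_prod_mul_prod_meets {E ι : Type*} [DecidableEq E] [DecidableEq ι]
    (U : Finset E) (S : ι → Finset E) (b : E → ℝ) (I : Finset ι) (hS : ∀ i ∈ I, S i ⊆ U)
    (hdisj : ∀ i ∈ I, ∀ j ∈ I, i ≠ j → Disjoint (S i) (S j)) (a : E → ℝ) :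
    ∑ T ∈ U.powerset, (∏ e ∈ T, a e) * (∏ e ∈ U \ T, b e) *
        ∏ i ∈ I, (if ∃ e ∈ S i, e ∈ T then (1 : ℝ) else 0) =
      (∏ e ∈ U \ I.biUnion S, (a e + b e)) *
        ∏ i ∈ I, (∏ e ∈ S i, (a e + b e) - ∏ e ∈ S i, b e) := by
  induction I using Finset.induction_on generalizing a with
  | empty => simp [Finset.prod_add]
  | insert i I hi ih =>
    have hS' : ∀ j ∈ I, S j ⊆ U := fun j hj => hS j (Finset.mem_insert_of_mem hj)
    have hdisj' : ∀ j ∈ I, ∀ j' ∈ I, j ≠ j' → Disjoint (S j) (S j') := fun j hj j' hj' =>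
      hdisj j (Finset.mem_insert_of_mem hj) j' (Finset.mem_insert_of_mem hj')
    have hdi : ∀ j ∈ I, Disjoint (S i) (S j) := fun j hj =>
      hdisj i (Finset.mem_insert_self i I) j (Finset.mem_insert_of_mem hj)
        (fun h => hi (h ▸ hj))
    set a' : E → ℝ := fun e => if e ∈ S i then 0 else a e with ha'
    have hterm : ∀ T : Finset E, (∏ e ∈ T, a e) * (if ∃ e ∈ S i, e ∈ T then (1 : ℝ) else 0) =
        ∏ e ∈ T, a e - ∏ e ∈ T, a' e := by
      intro T
      split_ifs with h
      · obtain ⟨e, he, heT⟩ := h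
        rw [Finset.prod_eq_zero (i := e) (f := a') heT (by simp [ha', he])]
        ring
      · push Not at h
        rw [Finset.prod_congr rfl (g := a) (f := a') (fun e he => by
          simp only [ha']; rw [if_neg (fun h' => h e h' he)])]
        ring
    have hblock : ∀ j ∈ I, ∏ e ∈ S j, (a' e + b e) = ∏ e ∈ S j, (a e + b e) := by
      intro j hj
      refine Finset.prod_congr rfl fun e he => ?_
      simp only [ha']
      rw [if_neg (fun h => Finset.disjoint_left.mp (hdi j hj) h he)]
    have hblocks : ∏ j ∈ I, (∏ e ∈ S j, (a' e + b e) - ∏ e ∈ S j, b e) =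
        ∏ j ∈ I, (∏ e ∈ S j, (a e + b e) - ∏ e ∈ S j, b e) :=
      Finset.prod_congr rfl fun j hj => by rw [hblock j hj]
    have hsub : S i ⊆ U \ I.biUnion S := by
      intro e he
      rw [Finset.mem_sdiff, Finset.mem_biUnion]
      refine ⟨hS i (Finset.mem_insert_self i I) he, ?_⟩
      rintro ⟨j, hj, hej⟩
      exact Finset.disjoint_left.mp (hdi j hj) he hej
    have hsd : U \ (insert i I).biUnion S = (U \ I.biUnion S) \ S i := by
      ext e
      simp only [Finset.mem_sdiff, Finset.mem_biUnion, Finset.mem_insert, exists_eq_or_imp, not_or]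
      tauto
    have hsplit := Finset.prod_sdiff (f := fun e => a e + b e) hsub
    have hsplit' := Finset.prod_sdiff (f := fun e => a' e + b e) hsub
    have h1 : ∏ e ∈ (U \ I.biUnion S) \ S i, (a' e + b e) =
        ∏ e ∈ (U \ I.biUnion S) \ S i, (a e + b e) := by
      refine Finset.prod_congr rfl fun e he => ?_
      simp only [ha']
      rw [if_neg (Finset.mem_sdiff.mp he).2]
    have h2 : ∏ e ∈ S i, (a' e + b e) = ∏ e ∈ S i, b e := by
      refine Finset.prod_congr rfl fun e he => ?_
      simp [ha', he]
    have key : ∀ T : Finset E, (∏ e ∈ T, a e) * (∏ e ∈ U \ T, b e) *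
        ∏ j ∈ insert i I, (if ∃ e ∈ S j, e ∈ T then (1 : ℝ) else 0) =
        (∏ e ∈ T, a e) * (∏ e ∈ U \ T, b e) *
          ∏ j ∈ I, (if ∃ e ∈ S j, e ∈ T then (1 : ℝ) else 0) -
        (∏ e ∈ T, a' e) * (∏ e ∈ U \ T, b e) *
          ∏ j ∈ I, (if ∃ e ∈ S j, e ∈ T then (1 : ℝ) else 0) := by
      intro T
      rw [Finset.prod_insert hi, ← sub_mul, ← sub_mul, ← hterm T]
      ring
    rw [Finset.sum_congr rfl fun T _ => key T, Finset.sum_sub_distrib, ih hS' hdisj' a,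
      ih hS' hdisj' a', Finset.prod_insert hi, hsd,
      ← hsplit, ← hsplit', h1, h2, hblocks]
    ring

/-- The mass of a graph under `G(n,p)`. -/
noncomputable def gnpWeight {n : ℕ} (p : ℝ) (G : SimpleGraph (Fin n)) : ℝ :=
  p ^ Nat.card G.edgeSet * (1 - p) ^ (n * (n - 1) / 2 - Nat.card G.edgeSet)

open Classical in
/-- A bound on the `G(n,p)`-mass of the graphs whose edges inside `C` are exactly `D` and that have an edge
in each of the blocks `S i`. -/
theorem sum_gnpWeight_le {n : ℕ} {p : ℝ} (hp : p ∈ Set.Ioo (0 : ℝ) 1) {ι : Type*}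
    (C D : Finset (Sym2 (Fin n))) (S : ι → Finset (Sym2 (Fin n))) (I : Finset ι)
    (hDC : D ⊆ C) (hC : C ⊆ (⊤ : SimpleGraph (Fin n)).edgeFinset)
    (hS : ∀ i ∈ I, S i ⊆ (⊤ : SimpleGraph (Fin n)).edgeFinset)
    (hSC : ∀ i ∈ I, Disjoint (S i) C)
    (hdisj : ∀ i ∈ I, ∀ j ∈ I, i ≠ j → Disjoint (S i) (S j)) :
    ∑ G : SimpleGraph (Fin n),
        (if (∀ e ∈ C, e ∈ G.edgeSet ↔ e ∈ D) ∧ ∀ i ∈ I, ∃ e ∈ S i, e ∈ G.edgeSet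
          then gnpWeight p G else 0) ≤
      p ^ D.card * (1 - p) ^ (C.card - D.card) * ∏ i ∈ I, (1 - (1 - p) ^ (S i).card) := by
  obtain ⟨hp0, hp1⟩ := hp
  set U := (⊤ : SimpleGraph (Fin n)).edgeFinset with hU
  have hUcard : U.card = n * (n - 1) / 2 := by
    rw [hU, SimpleGraph.card_edgeFinset_top_eq_card_choose_two, Fintype.card_fin,
      Nat.choose_two_right]
  set a : Sym2 (Fin n) → ℝ := fun e => if e ∈ C ∧ e ∉ D then 0 else p with ha
  set b : Sym2 (Fin n) → ℝ := fun e => if e ∈ D then 0 else 1 - p with hb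
  have ha0 : ∀ e, 0 ≤ a e := fun e => by simp only [ha]; split_ifs <;> linarith
  have hb0 : ∀ e, 0 ≤ b e := fun e => by simp only [hb]; split_ifs <;> linarith
  set F : Finset (Sym2 (Fin n)) → ℝ := fun T => (∏ e ∈ T, a e) * (∏ e ∈ U \ T, b e) *
        ∏ i ∈ I, (if ∃ e ∈ S i, e ∈ T then (1 : ℝ) else 0) with hF
  have hF0 : ∀ T, 0 ≤ F T := fun T => by
    refine mul_nonneg (mul_nonneg (Finset.prod_nonneg fun e _ => ha0 e)
      (Finset.prod_nonneg fun e _ => hb0 e)) (Finset.prod_nonneg fun i _ => ?_)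
    split_ifs <;> norm_num
  have hGU : ∀ G : SimpleGraph (Fin n), G.edgeFinset ⊆ U := fun G =>
    SimpleGraph.edgeFinset_mono le_top
  have hle : ∀ G : SimpleGraph (Fin n),
      (if (∀ e ∈ C, e ∈ G.edgeSet ↔ e ∈ D) ∧ ∀ i ∈ I, ∃ e ∈ S i, e ∈ G.edgeSet
          then gnpWeight p G else 0) ≤ F G.edgeFinset := by
    intro G
    split_ifs with h
    · obtain ⟨h1, h2⟩ := h
      have e1 : ∏ e ∈ G.edgeFinset, a e = p ^ G.edgeFinset.card := by
        rw [← Finset.prod_const]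
        refine Finset.prod_congr rfl fun e he => if_neg ?_
        rintro ⟨heC, heD⟩
        exact heD ((h1 e heC).mp (SimpleGraph.mem_edgeFinset.mp he))
      have e2 : ∏ e ∈ U \ G.edgeFinset, b e = (1 - p) ^ (U.card - G.edgeFinset.card) := by
        rw [← Finset.card_sdiff_of_subset (hGU G), ← Finset.prod_const]
        refine Finset.prod_congr rfl fun e he => if_neg fun heD => ?_
        exact (Finset.mem_sdiff.mp he).2 (SimpleGraph.mem_edgeFinset.mpr ((h1 e (hDC heD)).mpr heD))
      have e3 : ∏ i ∈ I, (if ∃ e ∈ S i, e ∈ G.edgeFinset then (1 : ℝ) else 0) = 1 :=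
        Finset.prod_eq_one fun i hi => if_pos (by simpa using h2 i hi)
      have e4 : Nat.card G.edgeSet = G.edgeFinset.card := by
        rw [Nat.card_eq_fintype_card, SimpleGraph.edgeFinset_card]
      simp only [hF]
      rw [e1, e2, e3, mul_one, gnpWeight, e4, hUcard]
    · exact hF0 _
  have hinj : Set.InjOn (fun G : SimpleGraph (Fin n) => G.edgeFinset)
      (Finset.univ : Finset (SimpleGraph (Fin n))) :=
    fun G _ H _ h => SimpleGraph.edgeFinset_inj.mp h
  have hprodS : ∀ i ∈ I, ∏ e ∈ S i, (a e + b e) - ∏ e ∈ S i, b e = 1 - (1 - p) ^ (S i).card := by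
    intro i hi
    have hn : ∀ e ∈ S i, e ∉ C := fun e he => Finset.disjoint_left.mp (hSC i hi) he
    rw [Finset.prod_eq_one, Finset.prod_congr rfl (g := fun _ => 1 - p), Finset.prod_const]
    · intro e he
      exact if_neg fun h => hn e he (hDC h)
    · intro e he
      simp only [ha, hb]
      rw [if_neg fun h => hn e he h.1, if_neg fun h => hn e he (hDC h)]
      ring
  have hprodC : ∏ e ∈ U \ I.biUnion S, (a e + b e) = p ^ D.card * (1 - p) ^ (C.card - D.card) := by
    have hsub : C ⊆ U \ I.biUnion S := by
      intro e he
      rw [Finset.mem_sdiff, Finset.mem_biUnion]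
      refine ⟨hC he, ?_⟩
      rintro ⟨i, hi, hei⟩
      exact Finset.disjoint_left.mp (hSC i hi) hei he
    rw [← Finset.prod_subset hsub, ← Finset.prod_sdiff hDC,
      Finset.prod_congr (s₁ := C \ D) rfl (g := fun _ => 1 - p), Finset.prod_const,
      Finset.prod_congr (s₁ := D) rfl (g := fun _ => p), Finset.prod_const,
      Finset.card_sdiff_of_subset hDC, mul_comm]
    · intro e he
      simp [ha, hb, he]
    · intro e he
      obtain ⟨h1, h2⟩ := Finset.mem_sdiff.mp he
      simp [ha, hb, h1, h2]
    · intro e _ he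
      have heD : e ∉ D := fun h => he (hDC h)
      simp [ha, hb, he, heD]
  calc _ ≤ ∑ G : SimpleGraph (Fin n), F G.edgeFinset := Finset.sum_le_sum fun G _ => hle G
    _ = ∑ T ∈ Finset.univ.image (fun G : SimpleGraph (Fin n) => G.edgeFinset), F T :=
        (Finset.sum_image hinj).symm
    _ ≤ ∑ T ∈ U.powerset, F T := by
        refine Finset.sum_le_sum_of_subset_of_nonneg ?_ fun T _ _ => hF0 T
        intro T hT
        obtain ⟨G, -, rfl⟩ := Finset.mem_image.mp hT
        exact Finset.mem_powerset.mpr (hGU G)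
    _ = _ := by
        simp only [hF]
        rw [sum_powerset_prod_mul_prod_meets U S b I hS hdisj a, hprodC,
          Finset.prod_congr rfl hprodS]

/-- The potential edges between two vertex sets. -/
def edgesBetween {V : Type*} [DecidableEq V] (A B : Finset V) : Finset (Sym2 V) :=
  (A ×ˢ B).image fun q => s(q.1, q.2)

theorem mem_edgesBetween {V : Type*} [DecidableEq V] {A B : Finset V} {e : Sym2 V} :
    e ∈ edgesBetween A B ↔ ∃ u ∈ A, ∃ v ∈ B, s(u, v) = e := by
  simp only [edgesBetween, Finset.mem_image, Finset.mem_product, Prod.exists]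
  constructor
  · rintro ⟨u, v, ⟨hu, hv⟩, h⟩
    exact ⟨u, hu, v, hv, h⟩
  · rintro ⟨u, hu, v, hv, h⟩
    exact ⟨u, v, ⟨hu, hv⟩, h⟩

theorem card_edgesBetween {V : Type*} [DecidableEq V] {A B : Finset V} (h : Disjoint A B) :
    (edgesBetween A B).card = A.card * B.card := by
  rw [edgesBetween, Finset.card_image_of_injOn, Finset.card_product]
  rintro ⟨u, v⟩ huv ⟨u', v'⟩ huv' heq
  simp only [Finset.coe_product, Set.mem_prod, Finset.mem_coe] at huv huv'
  simp only [Sym2.eq_iff] at heq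
  rcases heq with ⟨rfl, rfl⟩ | ⟨rfl, rfl⟩
  · rfl
  · exact absurd huv'.2 (Finset.disjoint_left.mp h huv.1)

theorem edgesBetween_subset_edgeFinset_top {V : Type*} [DecidableEq V] [Fintype V]
    [Fintype (⊤ : SimpleGraph V).edgeSet] {A B : Finset V} (h : Disjoint A B) :
    edgesBetween A B ⊆ (⊤ : SimpleGraph V).edgeFinset := by
  intro e he
  obtain ⟨u, hu, v, hv, rfl⟩ := mem_edgesBetween.mp he
  rw [SimpleGraph.mem_edgeFinset, SimpleGraph.mem_edgeSet, SimpleGraph.top_adj]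
  rintro rfl
  exact Finset.disjoint_left.mp h hu hv

/-- If `A` avoids both `A'` and `B'`, no potential edge at `A` runs between `A'` and `B'`. -/
theorem disjoint_edgesBetween {V : Type*} [DecidableEq V] {A B A' B' : Finset V}
    (h : Disjoint A A') (h' : Disjoint A B') :
    Disjoint (edgesBetween A B) (edgesBetween A' B') := by
  rw [Finset.disjoint_left]
  intro e he he'
  obtain ⟨u, hu, v, hv, rfl⟩ := mem_edgesBetween.mp he
  obtain ⟨u', hu', v', hv', heq⟩ := mem_edgesBetween.mp he'
  rcases Sym2.eq_iff.mp heq with ⟨rfl, rfl⟩ | ⟨rfl, rfl⟩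
  · exact Finset.disjoint_left.mp h hu hu'
  · exact Finset.disjoint_left.mp h' hu hv'

theorem edgesBetween_comm {V : Type*} [DecidableEq V] (A B : Finset V) :
    edgesBetween A B = edgesBetween B A := by
  ext e
  simp only [mem_edgesBetween]
  constructor <;> rintro ⟨u, hu, v, hv, rfl⟩ <;> exact ⟨v, hv, u, hu, Sym2.eq_swap⟩

open Classical in
/-- A bound on the probability that a given tuple of the right shape is special. -/
theorem sum_gnpWeight_specialTuple_le {n : ℕ} {p : ℝ} (hp : p ∈ Set.Ioo (0 : ℝ) 1)
    {X₁ X₂ X₃ : Finset (Fin n)} {x₁ x₂ x₃ : Fin n} (h₁₂ : Disjoint X₁ X₂) (h₁₃ : Disjoint X₁ X₃)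
    (h₂₃ : Disjoint X₂ X₃) (hx₁ : x₁ ∈ X₁) (hx₂ : x₂ ∈ X₂) (hx₃ : x₃ ∈ X₃) :
    ∑ G : SimpleGraph (Fin n),
        (if SpecialTuple G X₁ X₂ X₃ x₁ x₂ x₃ then gnpWeight p G else 0) ≤
      p ^ 3 * (1 - p) ^ (X₁.card * X₂.card + X₁.card * X₃.card + X₂.card * X₃.card - 3) *
        ((1 - (1 - p) ^ X₁.card) * (1 - (1 - p) ^ X₂.card) * (1 - (1 - p) ^ X₃.card)) ^
          (n - (X₁.card + X₂.card + X₃.card)) := by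
  set C := edgesBetween X₁ X₂ ∪ edgesBetween X₁ X₃ ∪ edgesBetween X₂ X₃ with hCdef
  set D : Finset (Sym2 (Fin n)) := {s(x₁, x₂), s(x₁, x₃), s(x₂, x₃)} with hDdef
  set Y : Fin 3 → Finset (Fin n) := ![X₁, X₂, X₃]
  set W : Finset (Fin n) := (X₁ ∪ X₂ ∪ X₃)ᶜ with hW
  set S : Fin n × Fin 3 → Finset (Sym2 (Fin n)) := fun i => edgesBetween {i.1} (Y i.2) with hSdef
  set I : Finset (Fin n × Fin 3) := W ×ˢ Finset.univ with hI
  have hx₁₂ : x₁ ≠ x₂ := fun h => Finset.disjoint_left.mp h₁₂ hx₁ (h ▸ hx₂)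
  have hx₁₃ : x₁ ≠ x₃ := fun h => Finset.disjoint_left.mp h₁₃ hx₁ (h ▸ hx₃)
  have hx₂₃ : x₂ ≠ x₃ := fun h => Finset.disjoint_left.mp h₂₃ hx₂ (h ▸ hx₃)
  have hWX : ∀ v ∈ W, v ∉ X₁ ∧ v ∉ X₂ ∧ v ∉ X₃ := by
    intro v hv
    simp only [hW, Finset.mem_compl, Finset.mem_union] at hv
    tauto
  have hWY : ∀ v ∈ W, ∀ j, v ∉ Y j := by
    intro v hv j
    obtain ⟨h1, h2, h3⟩ := hWX v hv
    fin_cases j <;> assumption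
  have hYdisj : ∀ i j, i ≠ j → Disjoint (Y i) (Y j) := by
    intro i j hij
    fin_cases i <;> fin_cases j <;>
      first
      | exact absurd rfl hij
      | exact h₁₂
      | exact h₁₃
      | exact h₂₃
      | exact h₁₂.symm
      | exact h₁₃.symm
      | exact h₂₃.symm
  have hDC : D ⊆ C := by
    intro e he
    simp only [hDdef, Finset.mem_insert, Finset.mem_singleton] at he
    simp only [hCdef, Finset.mem_union, mem_edgesBetween]
    rcases he with rfl | rfl | rfl
    · exact Or.inl (Or.inl ⟨_, hx₁, _, hx₂, rfl⟩)
    · exact Or.inl (Or.inr ⟨_, hx₁, _, hx₃, rfl⟩)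
    · exact Or.inr ⟨_, hx₂, _, hx₃, rfl⟩
  have hC : C ⊆ (⊤ : SimpleGraph (Fin n)).edgeFinset :=
    Finset.union_subset (Finset.union_subset (edgesBetween_subset_edgeFinset_top h₁₂)
      (edgesBetween_subset_edgeFinset_top h₁₃)) (edgesBetween_subset_edgeFinset_top h₂₃)
  have hS : ∀ i ∈ I, S i ⊆ (⊤ : SimpleGraph (Fin n)).edgeFinset := by
    rintro ⟨v, j⟩ hi
    exact edgesBetween_subset_edgeFinset_top
      (Finset.disjoint_singleton_left.mpr (hWY v (Finset.mem_product.mp hi).1 j))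
  have hSC : ∀ i ∈ I, Disjoint (S i) C := by
    rintro ⟨v, j⟩ hi
    obtain ⟨h1, h2, h3⟩ := hWX v (Finset.mem_product.mp hi).1
    simp only [hCdef, Finset.disjoint_union_right]
    rw [← Finset.disjoint_singleton_left] at h1 h2 h3
    exact ⟨⟨disjoint_edgesBetween h1 h2, disjoint_edgesBetween h1 h3⟩,
      disjoint_edgesBetween h2 h3⟩
  have hdisj : ∀ i ∈ I, ∀ j ∈ I, i ≠ j → Disjoint (S i) (S j) := by
    rintro ⟨v, i⟩ hi ⟨w, j⟩ hj hne
    have hv := hWY v (Finset.mem_product.mp hi).1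
    have hw := hWY w (Finset.mem_product.mp hj).1
    by_cases hvw : v = w
    · subst hvw
      have hij : i ≠ j := fun h => hne (by rw [h])
      simp only [hSdef]
      rw [edgesBetween_comm]
      exact disjoint_edgesBetween (Finset.disjoint_singleton_right.mpr (hv i)) (hYdisj i j hij)
    · exact disjoint_edgesBetween (by simpa using hvw)
        (Finset.disjoint_singleton_left.mpr (hv j))
  have hCcard : C.card = X₁.card * X₂.card + X₁.card * X₃.card + X₂.card * X₃.card := by
    rw [hCdef, Finset.card_union_of_disjoint, Finset.card_union_of_disjoint,
      card_edgesBetween h₁₂, card_edgesBetween h₁₃, card_edgesBetween h₂₃]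
    · rw [edgesBetween_comm]
      exact disjoint_edgesBetween h₁₂.symm h₂₃
    · rw [Finset.disjoint_union_left]
      exact ⟨disjoint_edgesBetween h₁₂ h₁₃, disjoint_edgesBetween h₁₂ h₁₃⟩
  have hDcard : D.card = 3 := by
    rw [hDdef, Finset.card_eq_three]
    refine ⟨_, _, _, ?_, ?_, ?_, rfl⟩ <;> simp only [ne_eq, Sym2.eq_iff] <;> grind
  have hXcard : W.card = n - (X₁.card + X₂.card + X₃.card) := by
    rw [hW, Finset.card_compl, Fintype.card_fin, Finset.card_union_of_disjoint,
      Finset.card_union_of_disjoint h₁₂]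
    exact Finset.disjoint_union_left.mpr ⟨h₁₃, h₂₃⟩
  have hprod : ∏ i ∈ I, (1 - (1 - p) ^ (S i).card) =
      ((1 - (1 - p) ^ X₁.card) * (1 - (1 - p) ^ X₂.card) * (1 - (1 - p) ^ X₃.card)) ^
          (n - (X₁.card + X₂.card + X₃.card)) := by
    rw [hI, Finset.prod_product, ← hXcard, ← Finset.prod_const]
    refine Finset.prod_congr rfl fun v hv => ?_
    have hc : ∀ j, (S (v, j)).card = (Y j).card := fun j => by
      simp only [hSdef]
      rw [card_edgesBetween (Finset.disjoint_singleton_left.mpr (hWY v hv j)),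
        Finset.card_singleton, one_mul]
    simp only [hc, Fin.prod_univ_three]
    rfl
  have hw0 : ∀ G : SimpleGraph (Fin n), 0 ≤ gnpWeight p G := fun G =>
    mul_nonneg (pow_nonneg hp.1.le _) (pow_nonneg (sub_nonneg.mpr hp.2.le) _)
  have hmass := sum_gnpWeight_le hp C D S I hDC hC hS hSC hdisj
  rw [hDcard, hCcard, hprod] at hmass
  refine le_trans (Finset.sum_le_sum fun G _ => ?_) hmass
  by_cases hsp : SpecialTuple G X₁ X₂ X₃ x₁ x₂ x₃
  · rw [if_pos hsp, if_pos]
    obtain ⟨-, -, -, -, -, -, hout, e₁₂, e₁₃, e₂₃⟩ := hsp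
    constructor
    · intro e he
      constructor
      · intro heG
        simp only [hCdef, Finset.mem_union, mem_edgesBetween] at he
        simp only [hDdef, Finset.mem_insert, Finset.mem_singleton]
        rcases he with (⟨u, hu, v, hv, rfl⟩ | ⟨u, hu, v, hv, rfl⟩) | ⟨u, hu, v, hv, rfl⟩
        · obtain ⟨rfl, rfl⟩ := (e₁₂ u hu v hv).mp heG
          exact Or.inl rfl
        · obtain ⟨rfl, rfl⟩ := (e₁₃ u hu v hv).mp heG
          exact Or.inr (Or.inl rfl)
        · obtain ⟨rfl, rfl⟩ := (e₂₃ u hu v hv).mp heG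
          exact Or.inr (Or.inr rfl)
      · intro heD
        simp only [hDdef, Finset.mem_insert, Finset.mem_singleton] at heD
        rcases heD with rfl | rfl | rfl
        · exact (e₁₂ _ hx₁ _ hx₂).mpr ⟨rfl, rfl⟩
        · exact (e₁₃ _ hx₁ _ hx₃).mpr ⟨rfl, rfl⟩
        · exact (e₂₃ _ hx₂ _ hx₃).mpr ⟨rfl, rfl⟩
    · rintro ⟨v, j⟩ hi
      obtain ⟨h1, h2, h3⟩ := hWX v (Finset.mem_product.mp hi).1
      have hex : ∃ u ∈ Y j, G.Adj v u := by
        obtain ⟨a1, a2, a3⟩ := hout v h1 h2 h3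
        fin_cases j <;> assumption
      obtain ⟨u, hu, huv⟩ := hex
      exact ⟨s(v, u), mem_edgesBetween.mpr ⟨v, Finset.mem_singleton_self v, u, hu, rfl⟩, huv⟩
  · rw [if_neg hsp]
    split_ifs
    · exact hw0 G
    · exact le_rfl

theorem integral_gnp {n : ℕ} {p : ℝ} (hp : p ∈ Set.Ioo (0 : ℝ) 1)
    (F : SimpleGraph (Fin n) → ℝ) :
    ∫ G, F G ∂ gnp n p = ∑ G : SimpleGraph (Fin n), gnpWeight p G * F G := by
  have hms : MeasurableSingletonClass (SimpleGraph (Fin n)) := ⟨fun _ => trivial⟩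
  rw [gnp, Measure.sum_fintype, integral_finsetSum_measure]
  · refine Finset.sum_congr rfl fun G _ => ?_
    rw [integral_smul_measure, integral_dirac, ENNReal.toReal_ofReal, smul_eq_mul, gnpWeight]
    exact mul_nonneg (pow_nonneg hp.1.le _) (pow_nonneg (sub_nonneg.mpr hp.2.le) _)
  · intro G _
    exact (Integrable.of_finite (μ := Measure.dirac G)).smul_measure ENNReal.ofReal_ne_top

open Classical in
/-- A bound on the number of triples of pointed sets of prescribed sizes. -/
theorem card_pointed_triples_le (n k l m : ℕ) :
    (Finset.univ.filter fun t : Finset (Fin n) × Finset (Fin n) × Finset (Fin n) ×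
        Fin n × Fin n × Fin n =>
      t.1.card = k ∧ t.2.1.card = l ∧ t.2.2.1.card = m ∧
      t.2.2.2.1 ∈ t.1 ∧ t.2.2.2.2.1 ∈ t.2.1 ∧ t.2.2.2.2.2 ∈ t.2.2.1).card ≤
      (n.choose k * k) * ((n.choose l * l) * (n.choose m * m)) := by
  set A : ℕ → Finset (Σ _ : Finset (Fin n), Fin n) := fun r =>
    (Finset.powersetCard r Finset.univ).sigma fun X => X with hA
  have hcard : ∀ r, (A r).card = n.choose r * r := by
    intro r
    simp only [hA]
    rw [Finset.card_sigma, Finset.sum_congr rfl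
      (fun X hX => (Finset.mem_powersetCard.mp hX).2), Finset.sum_const,
      Finset.card_powersetCard, Finset.card_univ, Fintype.card_fin, smul_eq_mul]
  rw [← hcard k, ← hcard l, ← hcard m, ← Finset.card_product, ← Finset.card_product]
  refine Finset.card_le_card_of_injOn
    (fun t => (⟨t.1, t.2.2.2.1⟩, ⟨t.2.1, t.2.2.2.2.1⟩, ⟨t.2.2.1, t.2.2.2.2.2⟩)) ?_ ?_
  · rintro ⟨X₁, X₂, X₃, x₁, x₂, x₃⟩ ht
    simpa [hA, and_assoc, and_left_comm, and_comm] using ht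
  · rintro ⟨X₁, X₂, X₃, x₁, x₂, x₃⟩ - ⟨Y₁, Y₂, Y₃, y₁, y₂, y₃⟩ - h
    simp only [Prod.mk.injEq, Sigma.mk.injEq, heq_eq_eq] at h ⊢
    tauto

theorem choose_le_exp {n k : ℕ} (hk : 0 < k) (hkn : k ≤ n) :
    (n.choose k : ℝ) ≤ exp (k * log ((n : ℝ) / k) + k) := by
  have hk' : (0 : ℝ) < k := by exact_mod_cast hk
  have hn' : (0 : ℝ) < n := by exact_mod_cast hk.trans_le hkn
  have hfac : (0 : ℝ) < k.factorial := by exact_mod_cast k.factorial_pos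
  have h1 : (k : ℝ) ^ k / k.factorial ≤ exp k := pow_div_factorial_le_exp _ hk'.le k
  have h2 : exp (k * log ((n : ℝ) / k)) = (n : ℝ) ^ k / (k : ℝ) ^ k := by
    rw [mul_comm, exp_mul, exp_log (div_pos hn' hk'), rpow_natCast, div_pow]
  calc (n.choose k : ℝ) ≤ (n : ℝ) ^ k / k.factorial := Nat.choose_le_pow_div k n
    _ = (n : ℝ) ^ k / (k : ℝ) ^ k * ((k : ℝ) ^ k / k.factorial) := by
        field_simp
    _ ≤ (n : ℝ) ^ k / (k : ℝ) ^ k * exp k := by gcongr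
    _ = _ := by rw [exp_add, h2]

open Classical in
theorem expX_le {n : ℕ} {p : ℝ} (hp : p ∈ Set.Ioo (0 : ℝ) 1) (k l m : ℕ) :
    expX n p k l m ≤ ((n.choose k * k : ℕ) * ((n.choose l * l : ℕ) * (n.choose m * m : ℕ))) *
      (p ^ 3 * (1 - p) ^ (k * l + k * m + l * m - 3) *
        ((1 - (1 - p) ^ k) * (1 - (1 - p) ^ l) * (1 - (1 - p) ^ m)) ^ (n - (k + l + m))) := by
  have hq0 : 0 ≤ 1 - p := sub_nonneg.mpr hp.2.le
  have hq : ∀ r : ℕ, 0 ≤ 1 - (1 - p) ^ r := fun r =>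
    sub_nonneg.mpr (pow_le_one₀ hq0 (by linarith [hp.1]))
  set P := p ^ 3 * (1 - p) ^ (k * l + k * m + l * m - 3) *
        ((1 - (1 - p) ^ k) * (1 - (1 - p) ^ l) * (1 - (1 - p) ^ m)) ^ (n - (k + l + m)) with hP
  have hP0 : 0 ≤ P := mul_nonneg (mul_nonneg (pow_nonneg hp.1.le _) (pow_nonneg hq0 _))
    (pow_nonneg (mul_nonneg (mul_nonneg (hq _) (hq _)) (hq _)) _)
  have hcount : ∀ G : SimpleGraph (Fin n), gnpWeight p G * (countX G k l m : ℝ) =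
      ∑ t : Finset (Fin n) × Finset (Fin n) × Finset (Fin n) × Fin n × Fin n × Fin n,
        if t.1.card = k ∧ t.2.1.card = l ∧ t.2.2.1.card = m ∧
          SpecialTuple G t.1 t.2.1 t.2.2.1 t.2.2.2.1 t.2.2.2.2.1 t.2.2.2.2.2
        then gnpWeight p G else 0 := by
    intro G
    rw [countX, Nat.card_eq_fintype_card, Fintype.card_subtype, ← Finset.sum_filter,
      Finset.sum_const, nsmul_eq_mul, mul_comm]
  rw [expX, integral_gnp hp, Finset.sum_congr rfl fun G _ => hcount G, Finset.sum_comm]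
  have hbound : ∀ t : Finset (Fin n) × Finset (Fin n) × Finset (Fin n) × Fin n × Fin n × Fin n,
      ∑ G : SimpleGraph (Fin n), (if t.1.card = k ∧ t.2.1.card = l ∧ t.2.2.1.card = m ∧
          SpecialTuple G t.1 t.2.1 t.2.2.1 t.2.2.2.1 t.2.2.2.2.1 t.2.2.2.2.2
        then gnpWeight p G else 0) ≤
      if t.1.card = k ∧ t.2.1.card = l ∧ t.2.2.1.card = m ∧
        t.2.2.2.1 ∈ t.1 ∧ t.2.2.2.2.1 ∈ t.2.1 ∧ t.2.2.2.2.2 ∈ t.2.2.1 then P else 0 := by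
    rintro ⟨X₁, X₂, X₃, x₁, x₂, x₃⟩
    dsimp only
    by_cases hshape : (X₁.card = k ∧ X₂.card = l ∧ X₃.card = m ∧ x₁ ∈ X₁ ∧ x₂ ∈ X₂ ∧ x₃ ∈ X₃) ∧
        Disjoint X₁ X₂ ∧ Disjoint X₁ X₃ ∧ Disjoint X₂ X₃
    · rw [if_pos hshape.1]
      obtain ⟨⟨h1, h2, h3, hx₁, hx₂, hx₃⟩, h₁₂, h₁₃, h₂₃⟩ := hshape
      have := sum_gnpWeight_specialTuple_le hp h₁₂ h₁₃ h₂₃ hx₁ hx₂ hx₃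
      rw [h1, h2, h3] at this
      simpa only [h1, h2, h3, true_and] using this
    · rw [Finset.sum_eq_zero]
      · split_ifs
        · exact hP0
        · exact le_rfl
      · intro G _
        refine if_neg ?_
        rintro ⟨h1, h2, h3, h₁₂, h₁₃, h₂₃, hx₁, hx₂, hx₃, -⟩
        exact hshape ⟨⟨h1, h2, h3, hx₁, hx₂, hx₃⟩, h₁₂, h₁₃, h₂₃⟩
  refine (Finset.sum_le_sum fun t _ => hbound t).trans ?_
  rw [← Finset.sum_filter, Finset.sum_const, nsmul_eq_mul]
  refine mul_le_mul_of_nonneg_right ?_ hP0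
  exact_mod_cast card_pointed_triples_le n k l m

theorem stmt2 {p : ℝ} (hp : p ∈ Set.Ioo (0 : ℝ) 1) {n k l m : ℕ}
    (hk : 0 < k) (hl : 0 < l) (hm : 0 < m) (h : k + l + m ≤ n) :
    expX n p k l m ≤
      Real.exp (
        ((k : ℝ) * Real.log ((n : ℝ) / k) + (l : ℝ) * Real.log ((n : ℝ) / l) +
          (m : ℝ) * Real.log ((n : ℝ) / m) + Real.log ((k : ℝ) * l * m) +
          (k : ℝ) + l + m
          - (n : ℝ) * ((1 - p) ^ k + (1 - p) ^ l + (1 - p) ^ m)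
          + ((k : ℝ) * l + (k : ℝ) * m + (l : ℝ) * m - 3) * Real.log (1 - p)
          + 3 * Real.log p)
        + ((k : ℝ) + l + m) * ((1 - p) ^ k + (1 - p) ^ l + (1 - p) ^ m)) := by
  obtain ⟨hp0, hp1⟩ := hp
  have hq0 : 0 < 1 - p := sub_pos.mpr hp1
  have hk' : (0 : ℝ) < k := by exact_mod_cast hk
  have hl' : (0 : ℝ) < l := by exact_mod_cast hl
  have hm' : (0 : ℝ) < m := by exact_mod_cast hm
  have hq : ∀ r : ℕ, 0 ≤ 1 - (1 - p) ^ r := fun r =>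
    sub_nonneg.mpr (pow_le_one₀ hq0.le (by linarith))
  have hq' : ∀ r : ℕ, 1 - (1 - p) ^ r ≤ exp (-(1 - p) ^ r) := fun r => by
    linarith [add_one_le_exp (-(1 - p) ^ r)]
  have hklm : 3 ≤ k * l + k * m + l * m := by
    have := Nat.mul_pos hk hl
    have := Nat.mul_pos hk hm
    have := Nat.mul_pos hl hm
    omega
  have hchoose : ∀ r : ℕ, 0 < r → r ≤ n →
      ((n.choose r * r : ℕ) : ℝ) ≤ exp (r * log ((n : ℝ) / r) + r + log r) := by
    intro r hr hrn
    rw [exp_add, exp_log (by exact_mod_cast hr : (0 : ℝ) < r)]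
    push_cast
    exact mul_le_mul_of_nonneg_right (choose_le_exp hr hrn) (Nat.cast_nonneg r)
  have hpp : p ^ 3 = exp (3 * log p) := by
    rw [mul_comm, exp_mul, exp_log hp0]
    exact (rpow_natCast p 3).symm
  have hqq : (1 - p) ^ (k * l + k * m + l * m - 3) =
      exp (((k : ℝ) * l + (k : ℝ) * m + (l : ℝ) * m - 3) * log (1 - p)) := by
    rw [mul_comm _ (log (1 - p)), exp_mul, exp_log hq0, ← rpow_natCast, Nat.cast_sub hklm]
    push_cast
    rfl
  have hout : ((1 - (1 - p) ^ k) * (1 - (1 - p) ^ l) * (1 - (1 - p) ^ m)) ^ (n - (k + l + m)) ≤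
      exp (((n : ℝ) - (k + l + m)) * (-(1 - p) ^ k + -(1 - p) ^ l + -(1 - p) ^ m)) := by
    have hcast : ((n : ℝ) - (k + l + m)) = ((n - (k + l + m) : ℕ) : ℝ) := by
      rw [Nat.cast_sub h]
      push_cast
      rfl
    rw [hcast, exp_nat_mul, exp_add, exp_add]
    refine pow_le_pow_left₀ (mul_nonneg (mul_nonneg (hq k) (hq l)) (hq m)) ?_ _
    exact mul_le_mul (mul_le_mul (hq' k) (hq' l) (hq l) (exp_pos _).le) (hq' m) (hq m)
      (by positivity)
  refine (expX_le ⟨hp0, hp1⟩ k l m).trans ?_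
  rw [hpp, hqq]
  calc _ ≤ (exp (k * log ((n : ℝ) / k) + k + log k) * (exp (l * log ((n : ℝ) / l) + l + log l) *
        exp (m * log ((n : ℝ) / m) + m + log m))) *
        (exp (3 * log p) *
          exp (((k : ℝ) * l + (k : ℝ) * m + (l : ℝ) * m - 3) * log (1 - p)) *
          exp (((n : ℝ) - (k + l + m)) * (-(1 - p) ^ k + -(1 - p) ^ l + -(1 - p) ^ m))) := by
        gcongr
        · exact mul_nonneg (by positivity)
            (pow_nonneg (mul_nonneg (mul_nonneg (hq k) (hq l)) (hq m)) _)
        · exact hchoose k hk (by omega)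
        · exact hchoose l hl (by omega)
        · exact hchoose m hm (by omega)
    _ = _ := by
        rw [log_mul (by positivity) hm'.ne', log_mul hk'.ne' hl'.ne']
        simp only [← exp_add]
        congr 1
        ring
end

section
/- Fix p ∈ (0,1). For every sufficiently large n, the equation ln(n/k) + 2k·ln(1−p) + 1/k − n·(1−p)^k·ln(1−p) + 1 = 0 has exactly one solution k* = k*(n) in the positive reals, and as n → ∞ this solution satisfies k*(n) = (ln n − ln ln n + ln ln(1/(1−p)))/ln(1/(1−p)) + O(ln ln n / ln n). -/
open Filter Real

/-- The function whose unique positive root is `k*(n)`: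
`ln(n/k) + 2k ln(1-p) + 1/k - n (1-p)^k ln(1-p) + 1`. -/
noncomputable def phi (p : ℝ) (n : ℕ) (k : ℝ) : ℝ :=
  Real.log (n / k) + 2 * k * Real.log (1 - p) + 1 / k
    - n * (1 - p) ^ k * Real.log (1 - p) + 1

/-- The function `f(k,ℓ,m)` from the paper, as a function of real variables. -/
noncomputable def fFun (p : ℝ) (n : ℕ) (q : ℝ × ℝ × ℝ) : ℝ :=
  q.1 * Real.log (n / q.1) + q.2.1 * Real.log (n / q.2.1) + q.2.2 * Real.log (n / q.2.2) +
    Real.log (q.1 * q.2.1 * q.2.2) + q.1 + q.2.1 + q.2.2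
    - n * ((1 - p) ^ q.1 + (1 - p) ^ q.2.1 + (1 - p) ^ q.2.2)
    + (q.1 * q.2.1 + q.1 * q.2.2 + q.2.1 * q.2.2 - 3) * Real.log (1 - p) + 3 * Real.log p

/-- `phi` written in terms of the rate `L = log (1 / (1 - p))`. -/
lemma phi_eq_exp {p : ℝ} (hp : p < 1) {n : ℕ} (hn : 0 < n) {k : ℝ} (hk : 0 < k) :
    phi p n k = Real.log n - Real.log k - 2 * (Real.log (1 / (1 - p)) * k) + 1 / k
      + n * Real.log (1 / (1 - p)) * Real.exp (-(Real.log (1 / (1 - p)) * k)) + 1 := by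
  have hn' : (n : ℝ) ≠ 0 := by positivity
  have hL : Real.log (1 / (1 - p)) = -Real.log (1 - p) := by
    rw [one_div, Real.log_inv]
  rw [phi, Real.log_div hn' hk.ne', Real.rpow_def_of_pos (by linarith), hL]
  ring_nf

lemma log_one_div_one_sub_pos {p : ℝ} (hp : p ∈ Set.Ioo (0 : ℝ) 1) :
    0 < Real.log (1 / (1 - p)) := by
  have h : 0 < 1 - p := by linarith [hp.2]
  exact Real.log_pos (by rw [lt_div_iff₀ h]; linarith [hp.1])

lemma phi_strictAntiOn {p : ℝ} (hp : p ∈ Set.Ioo (0 : ℝ) 1) {n : ℕ} (hn : 0 < n) :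
    StrictAntiOn (phi p n) (Set.Ioi 0) := by
  intro a ha b hb hab
  simp only [Set.mem_Ioi] at ha hb
  have hL := log_one_div_one_sub_pos hp
  rw [phi_eq_exp hp.2 hn ha, phi_eq_exp hp.2 hn hb]
  have h1 : Real.log a < Real.log b := Real.log_lt_log ha hab
  have h2 : 1 / b ≤ 1 / a := one_div_le_one_div_of_le ha hab.le
  have h3 := mul_le_mul_of_nonneg_left hab.le hL.le
  have h4 : (n : ℝ) * Real.log (1 / (1 - p)) * Real.exp (-(Real.log (1 / (1 - p)) * b))
      ≤ n * Real.log (1 / (1 - p)) * Real.exp (-(Real.log (1 / (1 - p)) * a)) := by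
    gcongr
  linarith

lemma phi_continuousOn {p : ℝ} (hp : p < 1) {n : ℕ} (hn : 0 < n) :
    ContinuousOn (phi p n) (Set.Ioi 0) := by
  have h : ContinuousOn (fun k : ℝ => Real.log n - Real.log k
      - 2 * (Real.log (1 / (1 - p)) * k) + 1 / k
      + n * Real.log (1 / (1 - p)) * Real.exp (-(Real.log (1 / (1 - p)) * k)) + 1)
      (Set.Ioi 0) := by
    have hne : ∀ x ∈ Set.Ioi (0 : ℝ), x ≠ 0 := fun x hx => ne_of_gt hx
    fun_prop (disch := assumption)
  exact h.congr fun k hk => phi_eq_exp hp hn hk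

/-- The approximate root and a slightly larger point eventually bracket the root of `phi`. -/
lemma eventually_phi_bracket {p : ℝ} (hp : p ∈ Set.Ioo (0 : ℝ) 1) :
    ∀ᶠ n : ℕ in atTop, ∃ a b : ℝ, 0 < n ∧ 0 < a ∧ a ≤ b ∧ 0 < phi p n a ∧ phi p n b < 0 ∧
      a = (Real.log n - Real.log (Real.log n) + Real.log (Real.log (1 / (1 - p)))) /
          Real.log (1 / (1 - p)) ∧
      b = a + 6 / Real.log (1 / (1 - p)) * (Real.log (Real.log n) / Real.log n) := by
  have hL := log_one_div_one_sub_pos hp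
  have hp1 := hp.2
  have hx : Tendsto (fun n : ℕ => Real.log n) atTop atTop :=
    Real.tendsto_log_atTop.comp tendsto_natCast_atTop_atTop
  have hy : Tendsto (fun n : ℕ => Real.log (Real.log n)) atTop atTop :=
    Real.tendsto_log_atTop.comp hx
  have hyx : ∀ᶠ n : ℕ in atTop, Real.log (Real.log n) ≤ 1 / 6 * Real.log n := by
    have h := (Real.isLittleO_log_id_atTop.comp_tendsto hx).bound
      (by norm_num : (0 : ℝ) < 1 / 6)
    filter_upwards [h, hx.eventually_ge_atTop 0] with n hn h0
    simp only [Function.comp_apply, id_eq, Real.norm_eq_abs, abs_of_nonneg h0] at hn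
    exact (le_abs_self _).trans hn
  set L := Real.log (1 / (1 - p)) with hLdef
  filter_upwards [eventually_gt_atTop 0, hyx, hx.eventually_gt_atTop 0,
    hx.eventually_ge_atTop (Real.log L),
    hx.eventually_ge_atTop (2 * (L - Real.log L)),
    hy.eventually_gt_atTop 0, hy.eventually_gt_atTop (Real.log L + Real.log 2),
    hy.eventually_gt_atTop (2 - 2 * Real.log L)] with n hn hyx hx0 hx1 hx2 hy0 hy1 hy2
  have hn' : (0 : ℝ) < n := by exact_mod_cast hn
  set x := Real.log n with hxdef
  set y := Real.log x with hydef
  set a := (x - y + Real.log L) / L with ha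
  set d := 6 / L * (y / x) with hd
  have hLa : L * a = x - y + Real.log L := by rw [ha]; field_simp
  have hLd : L * d = 6 * (y / x) := by rw [hd]; field_simp
  have ha1 : 1 ≤ a := by
    rw [ha, le_div_iff₀ hL]; linarith
  have ha0 : 0 < a := by linarith
  have hd0 : 0 ≤ d := by positivity
  have hexp : Real.exp (-(L * a)) = x / (n * L) := by
    rw [hLa, show -(x - y + Real.log L) = y - x - Real.log L by ring, Real.exp_sub,
      Real.exp_sub, hydef, Real.exp_log hx0, hxdef, Real.exp_log hn', Real.exp_log hL]
    field_simp
  refine ⟨a, a + d, hn, ha0, by linarith, ?_, ?_, rfl, rfl⟩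
  · rw [phi_eq_exp hp1 hn ha0, ← hLdef, hexp, hLa]
    have h1 : (n : ℝ) * L * (x / (n * L)) = x := by field_simp
    have h2 : Real.log a ≤ Real.log 2 + y - Real.log L := by
      rw [hydef, ← Real.log_mul (by norm_num) hx0.ne',
        ← Real.log_div (by positivity) hL.ne']
      refine Real.log_le_log ha0 ?_
      rw [ha]
      gcongr
      linarith
    have h3 : 0 < 1 / a := by positivity
    rw [h1]
    linarith
  · rw [phi_eq_exp hp1 hn (by linarith), ← hLdef, mul_add L a d, neg_add, Real.exp_add, hexp, hLa]
    have h1 : (n : ℝ) * L * (x / (n * L) * Real.exp (-(L * d))) = x * Real.exp (-(L * d)) := by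
      field_simp
    have h2 : 0 ≤ Real.log (a + d) := Real.log_nonneg (by linarith)
    have h3 : 1 / (a + d) ≤ 1 := by
      rw [div_le_one (by linarith)]; linarith
    have hu0 : 0 ≤ L * d := by positivity
    have hu1 : L * d ≤ 1 := by
      rw [hLd, ← mul_div_assoc, div_le_one hx0]; linarith
    have h4 : Real.exp (-(L * d)) ≤ 1 - L * d / 2 := by
      have h5 := Real.add_one_le_exp (L * d)
      rw [Real.exp_neg]
      refine (inv_anti₀ (by linarith) h5).trans ?_
      rw [inv_le_iff_one_le_mul₀ (by linarith)]
      nlinarith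
    have h6 : x * Real.exp (-(L * d)) ≤ x - 3 * y := by
      refine (mul_le_mul_of_nonneg_left h4 hx0.le).trans (le_of_eq ?_)
      rw [hLd]
      field_simp
      ring
    rw [h1]
    linarith

theorem stmt3 {p : ℝ} (hp : p ∈ Set.Ioo (0 : ℝ) 1) :
    (∃ N : ℕ, ∀ n : ℕ, N ≤ n → ∃! k : ℝ, 0 < k ∧ phi p n k = 0) ∧
    ∃ C : ℝ, 0 < C ∧ ∃ N' : ℕ, ∀ n : ℕ, N' ≤ n → ∀ k : ℝ, 0 < k → phi p n k = 0 →
      |k - (Real.log n - Real.log (Real.log n) + Real.log (Real.log (1 / (1 - p)))) /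
          Real.log (1 / (1 - p))|
        ≤ C * (Real.log (Real.log n) / Real.log n) := by
  obtain ⟨N, hN⟩ := eventually_atTop.1 (eventually_phi_bracket hp)
  have hL := log_one_div_one_sub_pos hp
  refine ⟨⟨N, fun n hn => ?_⟩, 6 / Real.log (1 / (1 - p)), by positivity, N,
    fun n hn k hk hphi => ?_⟩
  · obtain ⟨a, b, hn0, ha, hab, hpa, hpb, -, -⟩ := hN n hn
    have hcont : ContinuousOn (phi p n) (Set.Icc a b) :=
      (phi_continuousOn hp.2 hn0).mono fun x hx => lt_of_lt_of_le ha hx.1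
    obtain ⟨k, hk, hk0⟩ := intermediate_value_Icc' hab hcont ⟨hpb.le, hpa.le⟩
    have hkpos : 0 < k := lt_of_lt_of_le ha hk.1
    exact ⟨k, ⟨hkpos, hk0⟩, fun j hj =>
      (phi_strictAntiOn hp hn0).injOn hj.1 hkpos (hj.2.trans hk0.symm)⟩
  · obtain ⟨a, b, hn0, ha, hab, hpa, hpb, haeq, hbeq⟩ := hN n hn
    have hanti := phi_strictAntiOn hp hn0
    have h1 : a < k := (hanti.lt_iff_gt hk ha).1 (by rw [hphi]; exact hpa)
    have h2 : k < b := (hanti.lt_iff_gt (ha.trans_le hab) hk).1 (by rw [hphi]; exact hpb)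
    rw [← haeq, abs_of_pos (by linarith)]
    linarith
end

section
/- Fix p ∈ (0,1). Define f(k,ℓ,m) = k·ln(n/k) + ℓ·ln(n/ℓ) + m·ln(n/m) + ln(kℓm) + k + ℓ + m − n·((1−p)^k + (1−p)^ℓ + (1−p)^m) + (kℓ + km + ℓm − 3)·ln(1−p) + 3·ln p, and let k* = k*(n) be the unique positive solution of ln(n/k) + 2k·ln(1−p) + 1/k − n·(1−p)^k·ln(1−p) + 1 = 0. Then f(k*(n), k*(n), k*(n)) = O(ln ln n) as n → ∞. -/
open Filter Real

/-- A solution `r > 0` of `log r + a k (r - 1) = -(1 + 1/k)` is less than `1`. -/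
lemma lt_one_of_log_add_eq {a k r : ℝ} (ha : 0 < a) (hk : 0 < k)
    (h : Real.log r + a * k * (r - 1) = -(1 + 1 / k)) : r < 1 := by
  by_contra! hr1
  have h1 : 0 ≤ Real.log r := Real.log_nonneg hr1
  have h2 : 0 ≤ a * k * (r - 1) := mul_nonneg (by positivity) (by linarith)
  have h3 : 0 < 1 / k := by positivity
  linarith

/-- For large `k`, a solution `r > 0` of `log r + a k (r - 1) = -(1 + 1/k)` is at least `1/2`, and
`a k² (1 - r) - k r` is bounded uniformly in `k`. -/
lemma bounds_of_log_add_eq {a k r : ℝ} (ha : 0 < a) (hk : 1 ≤ k) (hak : 4 ≤ a * k) (hr : 0 < r)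
    (h : Real.log r + a * k * (r - 1) = -(1 + 1 / k)) :
    1 / 2 ≤ r ∧ |a * k ^ 2 * (1 - r) - k * r| ≤ 1 + 6 / a := by
  have hk0 : 0 < k := by linarith
  have hr1 : r < 1 := lt_one_of_log_add_eq ha hk0 h
  have hlog : Real.log r ≤ 0 := Real.log_nonpos hr.le hr1.le
  have hinv : 1 / k ≤ 1 := by rw [div_le_one hk0]; exact hk
  have h2 : a * k * (1 - r) ≤ 2 := by linarith
  have hhalf : 1 / 2 ≤ r := by nlinarith
  have hkr : k * (1 - r) ≤ 2 / a := by
    rw [le_div_iff₀ ha]; linarith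
  have hlog' : -(2 * (1 - r)) ≤ Real.log r := by
    have h3 := Real.one_sub_inv_le_log_of_pos hr
    have h4 : r⁻¹ ≤ 1 + 2 * (1 - r) := by
      rw [inv_le_iff_one_le_mul₀ hr]; nlinarith
    linarith
  have hklog : -(4 / a) ≤ k * Real.log r := by
    have h5 : 4 / a = 2 * (2 / a) := by ring
    nlinarith
  have hklog' : k * Real.log r ≤ 0 := mul_nonpos_of_nonneg_of_nonpos hk0.le hlog
  have hkr' : 0 ≤ k * (1 - r) := mul_nonneg hk0.le (by linarith)
  have hid : a * k ^ 2 * (1 - r) - k * r = 1 + k * Real.log r + k * (1 - r) := by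
    have h6 : Real.log r = -(1 + 1 / k) - a * k * (r - 1) := by linarith
    rw [h6]; field_simp; ring
  have h7 : 6 / a = 4 / a + 2 / a := by ring
  have h8 : 0 < 2 / a := by positivity
  have h9 : 0 < 4 / a := by positivity
  refine ⟨hhalf, ?_⟩
  rw [hid, abs_le]
  constructor <;> linarith

/-- The equation `phi p n k = 0` in terms of the ratio `r = n (1-p)^k / k`. -/
lemma log_add_eq_of_phi_eq_zero {p : ℝ} (hp : p < 1) {n : ℕ} (hn : 0 < n) {k r : ℝ} (hk : 0 < k)
    (hr : n * (1 - p) ^ k = k * r) (h : phi p n k = 0) :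
    Real.log r + -Real.log (1 - p) * k * (r - 1) = -(1 + 1 / k) := by
  have hq : 0 < 1 - p := by linarith
  have hn' : (0 : ℝ) < n := by exact_mod_cast hn
  have hr' : r = n / k * (1 - p) ^ k := by
    field_simp; linarith
  have hlog : Real.log r = Real.log (n / k) + k * Real.log (1 - p) := by
    rw [hr', Real.log_mul (by positivity) (by positivity), Real.log_rpow hq]
  unfold phi at h
  rw [hr] at h
  linear_combination h + hlog

/-- The diagonal value of `fFun` at a root of `phi`, in terms of `r = n (1-p)^k / k`. -/
lemma fFun_diag_of_phi_eq_zero {p : ℝ} {n : ℕ} {k r : ℝ} (hk : 0 < k)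
    (hr : n * (1 - p) ^ k = k * r) (h : phi p n k = 0) :
    fFun p n (k, k, k) = 3 * (-Real.log (1 - p) * k ^ 2 * (1 - r) - k * r + Real.log k
      + (Real.log p - Real.log (1 - p) - 1)) := by
  have hlog : Real.log (k * k * k) = 3 * Real.log k := by
    rw [Real.log_mul (by positivity) (by positivity), Real.log_mul (by positivity) (by positivity)]
    ring
  unfold phi at h
  rw [hr] at h
  have hlogn : Real.log (n / k) =
      -(2 * k * Real.log (1 - p) + 1 / k - k * r * Real.log (1 - p) + 1) := by linarith
  have hsum : (n : ℝ) * ((1 - p) ^ k + (1 - p) ^ k + (1 - p) ^ k) = 3 * (k * r) := by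
    rw [← hr]; ring
  simp only [fFun]
  rw [hsum, hlog, hlogn]
  field_simp
  ring

theorem stmt5 {p : ℝ} (hp : p ∈ Set.Ioo (0 : ℝ) 1) (kstar : ℕ → ℝ)
    (hks : ∀ n : ℕ, 0 < kstar n ∧ phi p n (kstar n) = 0) :
    ∃ C : ℝ, 0 < C ∧ ∀ᶠ n : ℕ in atTop,
      |fFun p n (kstar n, kstar n, kstar n)| ≤ C * Real.log (Real.log n) := by
  obtain ⟨hp0, hp1⟩ := hp
  have hq : 0 < 1 - p := by linarith
  set a : ℝ := -Real.log (1 - p) with ha_def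
  have ha : 0 < a := neg_pos.2 (Real.log_neg hq (by linarith))
  set c : ℝ := Real.log p - Real.log (1 - p) - 1
  set D : ℝ := 1 + 6 / a + |c| + |Real.log (2 / a)|
  have hD : 0 ≤ D := by positivity
  refine ⟨3 * (1 + D), by positivity, ?_⟩
  have hlogn : Tendsto (fun n : ℕ => Real.log n) atTop atTop :=
    Real.tendsto_log_atTop.comp tendsto_natCast_atTop_atTop
  have hloglogn := Real.tendsto_log_atTop.comp hlogn
  filter_upwards [hloglogn.eventually_ge_atTop 1, hlogn.eventually_ge_atTop (a + 1),
    hlogn.eventually_ge_atTop ((a + 1) * (4 / a)), hlogn.eventually_ge_atTop 1,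
    eventually_gt_atTop 0] with n hll hn1 hn2 hn3 hn0
  obtain ⟨hk, hphi⟩ := hks n
  generalize kstar n = k at hk hphi ⊢
  have hn' : (0 : ℝ) < n := by exact_mod_cast hn0
  obtain ⟨r, hr⟩ : ∃ r : ℝ, n * (1 - p) ^ k = k * r :=
    ⟨n * (1 - p) ^ k / k, by field_simp⟩
  have hr0 : 0 < r := by
    have : 0 < k * r := hr ▸ by positivity
    exact pos_of_mul_pos_right this hk.le
  have heq := log_add_eq_of_phi_eq_zero hp1 hn0 hk hr hphi
  rw [← ha_def] at heq
  have hr1 := lt_one_of_log_add_eq ha hk heq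
  have hlog : Real.log n - a * k = Real.log k + Real.log r := by
    rw [← Real.log_mul hk.ne' hr0.ne', ← hr, Real.log_mul hn'.ne' (by positivity),
      Real.log_rpow hq]
    ring
  have hlarge : Real.log n ≤ (a + 1) * k := by
    have h1 := Real.log_le_sub_one_of_pos hk
    have h2 := Real.log_neg hr0 hr1
    linarith
  have hk1 : 1 ≤ k := by nlinarith
  have hak : 4 ≤ a * k := by
    have h1 : 4 / a ≤ k := le_of_mul_le_mul_left (hn2.trans hlarge) (by linarith)
    rw [div_le_iff₀ ha] at h1
    linarith
  obtain ⟨hhalf, hbd⟩ := bounds_of_log_add_eq ha hk1 hak hr0 heq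
  have hlogk : 0 ≤ Real.log k := Real.log_nonneg hk1
  have hupper : k ≤ 2 / a * Real.log n := by
    have h1 := Real.one_sub_inv_le_log_of_pos hr0
    have h2 : r⁻¹ ≤ 2 := by
      rw [inv_le_comm₀ hr0 two_pos]; linarith
    rw [div_mul_eq_mul_div, le_div_iff₀ ha]
    linarith
  have hlogk' : Real.log k ≤ Real.log (2 / a) + Real.log (Real.log n) := by
    rw [← Real.log_mul (by positivity) (by linarith)]
    exact Real.log_le_log hk hupper
  have hll' : 1 ≤ Real.log (Real.log n) := hll
  rw [fFun_diag_of_phi_eq_zero hk hr hphi, ← ha_def, abs_mul, abs_of_pos (three_pos : (0 : ℝ) < 3),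
    mul_assoc (3 : ℝ)]
  refine mul_le_mul_of_nonneg_left ?_ (by norm_num)
  have h3 := abs_add_three (a * k ^ 2 * (1 - r) - k * r) (Real.log k) c
  rw [abs_of_nonneg hlogk] at h3
  have h4 := le_abs_self (Real.log (2 / a))
  have h5 : D ≤ D * Real.log (Real.log n) := le_mul_of_one_le_right hD hll'
  have h6 : D = 1 + 6 / a + |c| + |Real.log (2 / a)| := rfl
  linarith
end

section
/- Fix p ∈ (0,1) and for each i ∈ ℕ set n_i = ⌊(1/(1−p))^{i+1/2} · i⌋. Then the sum over all triples of positive integers (k,ℓ,m) with k + ℓ + m ≤ n_i of the expectation of X(k,ℓ,m) under G(n_i, p) tends to 0 as i → ∞. -/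
open MeasureTheory Filter Real

/-- The sequence `n_i = ⌊(1/(1-p))^{i+1/2} · i⌋`. -/
noncomputable def nseq1 (p : ℝ) (i : ℕ) : ℕ :=
  Nat.floor ((1 / (1 - p)) ^ ((i : ℝ) + 1 / 2) * i)

open Finset in
theorem sum_powerset_union_of_disjoint {α M : Type*} [DecidableEq α] [AddCommMonoid M]
    {A B : Finset α} (h : Disjoint A B) (g : Finset α → M) :
    ∑ S ∈ (A ∪ B).powerset, g S = ∑ S ∈ A.powerset, ∑ T ∈ B.powerset, g (S ∪ T) := by
  induction B using Finset.induction_on generalizing g with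
  | empty => simp
  | insert b B hb ih =>
    rw [Finset.disjoint_insert_right] at h
    have hbA : b ∉ A ∪ B := by simp [hb, h.1]
    rw [Finset.union_insert, Finset.sum_powerset_insert hbA, ih h.2, ih h.2,
      ← Finset.sum_add_distrib]
    refine Finset.sum_congr rfl fun S _ => ?_
    rw [Finset.sum_powerset_insert hb]
    simp only [Finset.union_insert]

/-- The probability that a `p`-random subset of `A` equals `S`. -/
noncomputable def subsetWeight {α : Type*} [DecidableEq α] (p : ℝ) (A S : Finset α) : ℝ :=
  p ^ S.card * (1 - p) ^ (A \ S).card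

theorem subsetWeight_nonneg {α : Type*} [DecidableEq α] {p : ℝ} (h0 : 0 ≤ p) (h1 : p ≤ 1)
    (A S : Finset α) : 0 ≤ subsetWeight p A S :=
  mul_nonneg (pow_nonneg h0 _) (pow_nonneg (by linarith) _)

theorem sum_subsetWeight {α : Type*} [DecidableEq α] (p : ℝ) (A : Finset α) :
    ∑ S ∈ A.powerset, subsetWeight p A S = 1 := by
  have := Finset.prod_add (fun _ : α => p) (fun _ => 1 - p) A
  simp only [Finset.prod_const, add_sub_cancel, one_pow] at this
  exact this.symm

theorem subsetWeight_union {α : Type*} [DecidableEq α] (p : ℝ) {A B S T : Finset α}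
    (h : Disjoint A B) (hS : S ⊆ A) (hT : T ⊆ B) :
    subsetWeight p (A ∪ B) (S ∪ T) = subsetWeight p A S * subsetWeight p B T := by
  have h1 : Disjoint S T := Finset.disjoint_of_subset_left hS (Finset.disjoint_of_subset_right hT h)
  have h2 : (A ∪ B) \ (S ∪ T) = (A \ S) ∪ (B \ T) := by
    ext a
    have hd := Finset.disjoint_left.1 h
    have := @hd a
    have := @hS a
    have := @hT a
    simp only [Finset.mem_sdiff, Finset.mem_union]
    tauto
  have h3 : Disjoint (A \ S) (B \ T) :=
    Finset.disjoint_of_subset_left Finset.sdiff_subset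
      (Finset.disjoint_of_subset_right Finset.sdiff_subset h)
  simp only [subsetWeight, h2, Finset.card_union_of_disjoint h1, Finset.card_union_of_disjoint h3,
    pow_add]
  ring

theorem sum_subsetWeight_union_mul {α : Type*} [DecidableEq α] (p : ℝ) {A B : Finset α}
    (h : Disjoint A B) (f g : Finset α → ℝ) :
    ∑ S ∈ (A ∪ B).powerset, subsetWeight p (A ∪ B) S * (f (S ∩ A) * g (S ∩ B)) =
      (∑ S ∈ A.powerset, subsetWeight p A S * f S) *
        ∑ S ∈ B.powerset, subsetWeight p B S * g S := by
  rw [sum_powerset_union_of_disjoint h, Finset.sum_mul_sum]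
  refine Finset.sum_congr rfl fun S hS => Finset.sum_congr rfl fun T hT => ?_
  rw [Finset.mem_powerset] at hS hT
  have h1 : (S ∪ T) ∩ A = S := by
    rw [Finset.union_inter_distrib_right, Finset.inter_eq_left.2 hS,
      Finset.disjoint_iff_inter_eq_empty.1 (Finset.disjoint_of_subset_left hT h.symm),
      Finset.union_empty]
  have h2 : (S ∪ T) ∩ B = T := by
    rw [Finset.union_inter_distrib_right, Finset.inter_eq_left.2 hT,
      Finset.disjoint_iff_inter_eq_empty.1 (Finset.disjoint_of_subset_left hS h),
      Finset.empty_union]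
  rw [h1, h2, subsetWeight_union p h hS hT]
  ring

theorem sum_subsetWeight_biUnion {α ι : Type*} [DecidableEq α] [DecidableEq ι] (p : ℝ)
    (J : Finset ι) (B : ι → Finset α) (F : ι → Finset α → ℝ)
    (hB : (J : Set ι).PairwiseDisjoint B) :
    ∑ S ∈ (J.biUnion B).powerset, subsetWeight p (J.biUnion B) S * ∏ j ∈ J, F j (S ∩ B j) =
      ∏ j ∈ J, ∑ S ∈ (B j).powerset, subsetWeight p (B j) S * F j S := by
  induction J using Finset.induction_on with
  | empty => simp [subsetWeight]
  | insert a J ha ih =>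
    rw [Finset.coe_insert, Set.pairwiseDisjoint_insert_of_notMem (by simpa using ha)] at hB
    have hd : Disjoint (B a) (J.biUnion B) := by
      rw [Finset.disjoint_biUnion_right]
      exact fun j hj => hB.2 j hj
    rw [Finset.prod_insert ha, ← ih hB.1, Finset.biUnion_insert,
      ← sum_subsetWeight_union_mul p hd]
    refine Finset.sum_congr rfl fun S _ => ?_
    rw [Finset.prod_insert ha]
    congr 2
    refine Finset.prod_congr rfl fun j hj => ?_
    rw [Finset.inter_assoc, Finset.inter_eq_right.2 (Finset.subset_biUnion_of_mem B hj)]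

theorem sum_subsetWeight_blocks {α ι : Type*} [DecidableEq α] [DecidableEq ι] (p : ℝ)
    (D : Finset α) (J : Finset ι) (B : ι → Finset α) (F : ι → Finset α → ℝ)
    (hB : (J : Set ι).PairwiseDisjoint B) (hD : ∀ j ∈ J, B j ⊆ D) :
    ∑ S ∈ D.powerset, subsetWeight p D S * ∏ j ∈ J, F j (S ∩ B j) =
      ∏ j ∈ J, ∑ S ∈ (B j).powerset, subsetWeight p (B j) S * F j S := by
  have hsub : J.biUnion B ⊆ D := Finset.biUnion_subset.2 hD
  have hu : J.biUnion B ∪ D \ J.biUnion B = D := Finset.union_sdiff_of_subset hsub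
  have key := sum_subsetWeight_union_mul p (Finset.disjoint_sdiff (s := J.biUnion B) (t := D))
    (fun S => ∏ j ∈ J, F j (S ∩ B j)) (fun _ => 1)
  simp only [mul_one, sum_subsetWeight, hu] at key
  rw [← sum_subsetWeight_biUnion p J B F hB, ← key]
  refine Finset.sum_congr rfl fun S _ => ?_
  congr 1
  refine Finset.prod_congr rfl fun j hj => ?_
  rw [Finset.inter_assoc, Finset.inter_eq_right.2 (Finset.subset_biUnion_of_mem B hj)]

theorem sum_subsetWeight_nonempty {α : Type*} [DecidableEq α] (p : ℝ) (A : Finset α) :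
    ∑ S ∈ A.powerset, subsetWeight p A S * (if S.Nonempty then 1 else 0) =
      1 - (1 - p) ^ A.card := by
  have h := sum_subsetWeight p A
  rw [← Finset.add_sum_erase _ _ (Finset.empty_mem_powerset A)] at h ⊢
  have h2 : ∑ S ∈ A.powerset.erase ∅, subsetWeight p A S * (if S.Nonempty then 1 else 0) =
      ∑ S ∈ A.powerset.erase ∅, subsetWeight p A S :=
    Finset.sum_congr rfl fun S hS => by
      rw [if_pos (Finset.nonempty_iff_ne_empty.2 (Finset.mem_erase.1 hS).1), mul_one]
  rw [h2]
  simp only [subsetWeight, Finset.card_empty, pow_zero, Finset.sdiff_empty, one_mul,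
    Finset.not_nonempty_empty, if_false, mul_zero, zero_add] at h ⊢
  linarith

theorem sum_subsetWeight_singleton {α : Type*} [DecidableEq α] (p : ℝ) (A : Finset α) {a : α}
    (ha : a ∈ A) :
    ∑ S ∈ A.powerset, subsetWeight p A S * (if S = {a} then 1 else 0) =
      p * (1 - p) ^ (A.card - 1) := by
  simp only [mul_ite, mul_one, mul_zero]
  rw [Finset.sum_ite_eq' A.powerset {a}, if_pos (by simpa using ha)]
  simp [subsetWeight, Finset.card_sdiff_of_subset (Finset.singleton_subset_iff.2 ha)]

theorem sum_simpleGraph_eq {V : Type*} [Fintype V] [DecidableEq V] [Fintype (SimpleGraph V)]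
    [∀ G : SimpleGraph V, Fintype G.edgeSet] (f : Finset (Sym2 V) → ℝ) :
    ∑ G : SimpleGraph V, f G.edgeFinset =
      ∑ S ∈ (Finset.univ.filter fun e : Sym2 V => ¬ e.IsDiag).powerset, f S := by
  refine Finset.sum_bij' (fun G _ => G.edgeFinset)
    (fun S _ => SimpleGraph.fromEdgeSet (S : Set (Sym2 V))) ?_ (fun _ _ => Finset.mem_univ _)
    ?_ ?_ (fun _ _ => rfl)
  · intro G _
    rw [Finset.mem_powerset]
    intro e he
    simpa using G.not_isDiag_of_mem_edgeFinset he
  · intro G _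
    simp
  · intro S hS
    rw [Finset.mem_powerset] at hS
    ext e
    have := @hS e
    simp only [Finset.mem_filter, Finset.mem_univ, true_and] at this
    simp only [Set.mem_toFinset, SimpleGraph.edgeFinset, SimpleGraph.edgeSet_fromEdgeSet, Set.mem_sdiff,
      Finset.mem_coe]
    rw [Sym2.mem_diagSet]
    tauto

theorem integral_gnp_s7 {n : ℕ} [Fintype (SimpleGraph (Fin n))]
    [∀ G : SimpleGraph (Fin n), Fintype G.edgeSet]
    {p : ℝ} (h0 : 0 ≤ p) (h1 : p ≤ 1) (f : SimpleGraph (Fin n) → ℝ) :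
    ∫ G, f G ∂ gnp n p = ∑ G : SimpleGraph (Fin n),
      subsetWeight p (Finset.univ.filter fun e : Sym2 (Fin n) => ¬ e.IsDiag) G.edgeFinset * f G := by
  have hcard : (Finset.univ.filter fun e : Sym2 (Fin n) => ¬ e.IsDiag).card =
      n * (n - 1) / 2 := by
    rw [← Fintype.card_subtype, Sym2.card_subtype_not_diag, Fintype.card_fin, Nat.choose_two_right]
  rw [gnp, Measure.sum_fintype, integral_finsetSum_measure]
  · refine Finset.sum_congr rfl fun G _ => ?_
    have hsub : G.edgeFinset ⊆ Finset.univ.filter fun e : Sym2 (Fin n) => ¬ e.IsDiag := by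
      intro e he
      simpa using G.not_isDiag_of_mem_edgeFinset he
    have hG : Nat.card G.edgeSet = G.edgeFinset.card := by
      rw [Nat.card_eq_fintype_card, SimpleGraph.edgeFinset_card]
    rw [integral_smul_measure, integral_dirac, subsetWeight,
      Finset.card_sdiff_of_subset hsub, hcard, hG, smul_eq_mul, ENNReal.toReal_ofReal]
    exact mul_nonneg (pow_nonneg h0 _) (pow_nonneg (by linarith) _)
  · intro G _
    exact (integrable_dirac (by simp)).smul_measure ENNReal.ofReal_ne_top

/-- The pairs between consecutive sets `X c`, `X (c + 1)`, and the pairs between a vertex `v`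
and a set `X j`. -/
def pairBlock {V : Type*} [DecidableEq V] (X : Fin 3 → Finset V) :
    Fin 3 ⊕ (V × Fin 3) → Finset (Sym2 V)
  | .inl c => (X c ×ˢ X (c + 1)).image fun e => s(e.1, e.2)
  | .inr (v, j) => (X j).image fun u => s(v, u)

theorem card_pairBlock_inl {V : Type*} [DecidableEq V] {X : Fin 3 → Finset V}
    (hX : ∀ i j v, v ∈ X i → v ∈ X j → i = j) (c : Fin 3) :
    (pairBlock X (.inl c)).card = (X c).card * (X (c + 1)).card := by
  rw [pairBlock, Finset.card_image_of_injOn, Finset.card_product]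
  rintro ⟨a, b⟩ h ⟨a', b'⟩ h' he
  simp only [Finset.coe_product, Set.mem_prod, Finset.mem_coe] at h h'
  rcases Sym2.eq_iff.1 he with ⟨rfl, rfl⟩ | ⟨rfl, rfl⟩
  · rfl
  · exact absurd (hX _ _ _ h.1 h'.2) (by fin_cases c <;> decide)

theorem card_pairBlock_inr {V : Type*} [DecidableEq V] (X : Fin 3 → Finset V) (v : V) (j : Fin 3) :
    (pairBlock X (.inr (v, j))).card = (X j).card :=
  Finset.card_image_of_injective _ fun _ _ h => Sym2.congr_right.1 h

theorem pairwiseDisjoint_pairBlock {V : Type*} [DecidableEq V] {X : Fin 3 → Finset V}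
    (hX : ∀ i j v, v ∈ X i → v ∈ X j → i = j) {O : Finset V} (hO : ∀ v ∈ O, ∀ j, v ∉ X j) :
    ((Finset.univ.disjSum (O ×ˢ Finset.univ) : Finset (Fin 3 ⊕ (V × Fin 3))) :
      Set (Fin 3 ⊕ (V × Fin 3))).PairwiseDisjoint (pairBlock X) := by
  intro x hx y hy hxy
  rw [Function.onFun, Finset.disjoint_left]
  intro e hex hey
  apply hxy
  rcases x with c | ⟨v, j⟩ <;> rcases y with c' | ⟨v', j'⟩ <;>
    simp only [pairBlock, Finset.mem_image, Finset.mem_product, Prod.exists, Finset.mem_coe,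
      Finset.inl_mem_disjSum, Finset.inr_mem_disjSum, Finset.mem_univ, and_true] at hex hey hx hy
  · obtain ⟨a, b, ⟨ha, hb⟩, rfl⟩ := hex
    obtain ⟨a', b', ⟨ha', hb'⟩, he⟩ := hey
    rcases Sym2.eq_iff.1 he with ⟨rfl, rfl⟩ | ⟨rfl, rfl⟩
    · rw [hX _ _ _ ha ha']
    · have h1 := hX _ _ _ ha hb'
      have h2 := hX _ _ _ hb ha'
      subst h1
      exact absurd h2 (by fin_cases c' <;> decide)
  · obtain ⟨a, b, ⟨ha, hb⟩, rfl⟩ := hex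
    obtain ⟨u, hu, he⟩ := hey
    rcases Sym2.eq_iff.1 he with ⟨rfl, rfl⟩ | ⟨rfl, rfl⟩
    · exact absurd ha (hO _ hy _)
    · exact absurd hb (hO _ hy _)
  · obtain ⟨a, b, ⟨ha, hb⟩, rfl⟩ := hey
    obtain ⟨u, hu, he⟩ := hex
    rcases Sym2.eq_iff.1 he with ⟨rfl, rfl⟩ | ⟨rfl, rfl⟩
    · exact absurd ha (hO _ hx _)
    · exact absurd hb (hO _ hx _)
  · obtain ⟨u, hu, rfl⟩ := hex
    obtain ⟨u', hu', he⟩ := hey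
    rcases Sym2.eq_iff.1 he with ⟨rfl, rfl⟩ | ⟨rfl, rfl⟩
    · rw [hX _ _ _ hu hu']
    · exact absurd hu (hO _ hy _)

theorem pairBlock_subset {V : Type*} [Fintype V] [DecidableEq V] {X : Fin 3 → Finset V}
    (hX : ∀ i j v, v ∈ X i → v ∈ X j → i = j) {O : Finset V} (hO : ∀ v ∈ O, ∀ j, v ∉ X j)
    {x : Fin 3 ⊕ (V × Fin 3)}
    (hx : x ∈ (Finset.univ.disjSum (O ×ˢ Finset.univ) : Finset (Fin 3 ⊕ (V × Fin 3)))) :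
    pairBlock X x ⊆ Finset.univ.filter fun e : Sym2 V => ¬ e.IsDiag := by
  intro e he
  rw [Finset.mem_filter]
  refine ⟨Finset.mem_univ _, ?_⟩
  rcases x with c | ⟨v, j⟩ <;>
    simp only [pairBlock, Finset.mem_image, Finset.mem_product, Prod.exists,
      Finset.inl_mem_disjSum, Finset.inr_mem_disjSum, Finset.mem_univ, and_true] at he hx
  · obtain ⟨a, b, ⟨ha, hb⟩, rfl⟩ := he
    rw [Sym2.mk_isDiag_iff]
    rintro rfl
    exact absurd (hX _ _ _ ha hb) (by fin_cases c <;> decide)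
  · obtain ⟨u, hu, rfl⟩ := he
    rw [Sym2.mk_isDiag_iff]
    rintro rfl
    exact hO _ hx _ hu

/-- The indicator that the edges inside a block are compatible with a special tuple. -/
def blockIndicator {V : Type*} [DecidableEq V] (x : Fin 3 → V) :
    Fin 3 ⊕ (V × Fin 3) → Finset (Sym2 V) → ℝ
  | .inl c => fun S => if S = {s(x c, x (c + 1))} then 1 else 0
  | .inr _ => fun S => if S.Nonempty then 1 else 0

theorem blockIndicator_nonneg {V : Type*} [DecidableEq V] (x : Fin 3 → V)
    (i : Fin 3 ⊕ (V × Fin 3)) (S : Finset (Sym2 V)) : 0 ≤ blockIndicator x i S := by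
  rcases i with c | v <;> simp only [blockIndicator] <;> split_ifs <;> norm_num

theorem blockIndicator_eq_one {n : ℕ} {X : Fin 3 → Finset (Fin n)} {x : Fin 3 → Fin n}
    (hx : ∀ i, x i ∈ X i) (G : SimpleGraph (Fin n)) [Fintype G.edgeSet]
    (hG : SpecialTuple G (X 0) (X 1) (X 2) (x 0) (x 1) (x 2)) {O : Finset (Fin n)}
    (hO : ∀ v ∈ O, ∀ j, v ∉ X j) {i : Fin 3 ⊕ (Fin n × Fin 3)}
    (hi : i ∈ Finset.univ.disjSum (O ×ˢ Finset.univ)) :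
    blockIndicator x i (G.edgeFinset ∩ pairBlock X i) = 1 := by
  obtain ⟨-, -, -, -, -, -, hout, h01, h02, h12⟩ := hG
  rcases i with c | ⟨v, j⟩
  · have hc : ∀ u ∈ X c, ∀ v ∈ X (c + 1), (G.Adj u v ↔ u = x c ∧ v = x (c + 1)) := by
      fin_cases c
      · exact h01
      · exact h12
      · intro u hu v hv
        exact G.adj_comm u v |>.trans ((h02 v hv u hu).trans and_comm)
    refine if_pos ?_
    ext e
    simp only [pairBlock, Finset.mem_inter, SimpleGraph.mem_edgeFinset, Finset.mem_image,
      Finset.mem_product, Prod.exists, Finset.mem_singleton]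
    constructor
    · rintro ⟨he, a, b, ⟨ha, hb⟩, rfl⟩
      obtain ⟨rfl, rfl⟩ := (hc a ha b hb).1 he
      rfl
    · rintro rfl
      exact ⟨(hc _ (hx c) _ (hx _)).2 ⟨rfl, rfl⟩, _, _, ⟨hx c, hx _⟩, rfl⟩
  · have hv : v ∈ O := by simpa using hi
    have hv' : ∃ u ∈ X j, G.Adj v u := by
      have := hout v (hO v hv 0) (hO v hv 1) (hO v hv 2)
      fin_cases j
      exacts [this.1, this.2.1, this.2.2]
    obtain ⟨u, hu, ha⟩ := hv'
    refine if_pos ⟨s(v, u), ?_⟩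
    simp only [pairBlock, Finset.mem_inter, SimpleGraph.mem_edgeFinset, Finset.mem_image]
    exact ⟨ha, u, hu, rfl⟩

theorem sum_subsetWeight_blockIndicator {V : Type*} [Fintype V] [DecidableEq V] (p : ℝ)
    {X : Fin 3 → Finset V} {x : Fin 3 → V} (hX : ∀ i j v, v ∈ X i → v ∈ X j → i = j)
    (hx : ∀ i, x i ∈ X i) {O : Finset V} (hO : ∀ v ∈ O, ∀ j, v ∉ X j) :
    ∑ S ∈ (Finset.univ.filter fun e : Sym2 V => ¬ e.IsDiag).powerset,
      subsetWeight p (Finset.univ.filter fun e : Sym2 V => ¬ e.IsDiag) S *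
        ∏ i ∈ Finset.univ.disjSum (O ×ˢ Finset.univ), blockIndicator x i (S ∩ pairBlock X i) =
      (∏ c : Fin 3, p * (1 - p) ^ ((X c).card * (X (c + 1)).card - 1)) *
        (∏ j : Fin 3, (1 - (1 - p) ^ (X j).card)) ^ O.card := by
  rw [sum_subsetWeight_blocks p _ _ _ (blockIndicator x) (pairwiseDisjoint_pairBlock hX hO)
    fun j hj => pairBlock_subset hX hO hj, Finset.prod_disjSum, Finset.prod_product]
  congr 1
  · refine Finset.prod_congr rfl fun c _ => ?_
    simp only [blockIndicator]
    rw [sum_subsetWeight_singleton, card_pairBlock_inl hX]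
    simp only [pairBlock, Finset.mem_image, Finset.mem_product, Prod.exists]
    exact ⟨_, _, ⟨hx c, hx _⟩, rfl⟩
  · rw [← Finset.prod_const]
    refine Finset.prod_congr rfl fun v _ => Finset.prod_congr rfl fun j _ => ?_
    simp only [blockIndicator]
    rw [sum_subsetWeight_nonempty, card_pairBlock_inr]

open Classical in
theorem sum_special_le {n : ℕ} {p : ℝ} (h0 : 0 ≤ p) (h1 : p ≤ 1) {X : Fin 3 → Finset (Fin n)}
    {x : Fin 3 → Fin n} (hX : ∀ i j v, v ∈ X i → v ∈ X j → i = j) (hx : ∀ i, x i ∈ X i) :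
    ∑ G : SimpleGraph (Fin n),
      subsetWeight p (Finset.univ.filter fun e : Sym2 (Fin n) => ¬ e.IsDiag) G.edgeFinset *
        (if SpecialTuple G (X 0) (X 1) (X 2) (x 0) (x 1) (x 2) then 1 else 0) ≤
      (∏ c : Fin 3, p * (1 - p) ^ ((X c).card * (X (c + 1)).card - 1)) *
        (∏ j : Fin 3, (1 - (1 - p) ^ (X j).card)) ^
          (n - ((X 0).card + (X 1).card + (X 2).card)) := by
  have hO : ∀ v ∈ (X 0 ∪ X 1 ∪ X 2)ᶜ, ∀ j, v ∉ X j := by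
    intro v hv j
    simp only [Finset.mem_compl, Finset.mem_union, not_or] at hv
    fin_cases j
    exacts [hv.1.1, hv.1.2, hv.2]
  have hdisj : ∀ i j, i ≠ j → Disjoint (X i) (X j) := fun i j hij =>
    Finset.disjoint_left.2 fun v hv hv' => hij (hX _ _ _ hv hv')
  have hOcard : (X 0 ∪ X 1 ∪ X 2)ᶜ.card = n - ((X 0).card + (X 1).card + (X 2).card) := by
    rw [Finset.card_compl, Fintype.card_fin, Finset.card_union_of_disjoint,
      Finset.card_union_of_disjoint (hdisj 0 1 (by decide))]
    exact Finset.disjoint_union_left.2 ⟨hdisj 0 2 (by decide), hdisj 1 2 (by decide)⟩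
  rw [← hOcard, ← sum_subsetWeight_blockIndicator p hX hx hO, ← sum_simpleGraph_eq]
  refine Finset.sum_le_sum fun G _ =>
    mul_le_mul_of_nonneg_left ?_ (subsetWeight_nonneg h0 h1 _ _)
  split_ifs with hG
  · exact (Finset.prod_eq_one fun i hi => blockIndicator_eq_one hx G hG hO hi).ge
  · exact Finset.prod_nonneg fun j _ => blockIndicator_nonneg _ _ _

theorem card_tuples_le (n k l m : ℕ)
    (A : Finset (Finset (Fin n) × Finset (Fin n) × Finset (Fin n) × Fin n × Fin n × Fin n))
    (hA : ∀ t ∈ A, (t.1.card = k ∧ t.2.1.card = l ∧ t.2.2.1.card = m) ∧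
      (Disjoint t.1 t.2.1 ∧ Disjoint t.1 t.2.2.1 ∧ Disjoint t.2.1 t.2.2.1) ∧
      t.2.2.2.1 ∈ t.1 ∧ t.2.2.2.2.1 ∈ t.2.1 ∧ t.2.2.2.2.2 ∈ t.2.2.1) :
    A.card ≤ n.choose k * ((n - k).choose l * ((n - k - l).choose m * (k * (l * m)))) := by
  classical
  let S : Finset (Σ _ : Finset (Fin n), Σ _ : Finset (Fin n), Σ _ : Finset (Fin n),
      Fin n × Fin n × Fin n) :=
    (Finset.powersetCard k Finset.univ).sigma fun X =>
      (Finset.powersetCard l Xᶜ).sigma fun Y =>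
        (Finset.powersetCard m (Xᶜ \ Y)).sigma fun Z => X ×ˢ Y ×ˢ Z
  have hS : S.card = n.choose k * ((n - k).choose l * ((n - k - l).choose m * (k * (l * m)))) := by
    rw [Finset.card_sigma, ← Finset.card_fin n, ← Finset.card_powersetCard, ← smul_eq_mul,
      ← Finset.sum_const, Finset.card_fin n]
    refine Finset.sum_congr rfl fun X hX => ?_
    have hX' : Xᶜ.card = n - k := by
      rw [Finset.card_compl, Fintype.card_fin, (Finset.mem_powersetCard.1 hX).2]
    rw [Finset.card_sigma, ← hX', ← Finset.card_powersetCard, ← smul_eq_mul, ← Finset.sum_const]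
    refine Finset.sum_congr rfl fun Y hY => ?_
    have hY' : (Xᶜ \ Y).card = Xᶜ.card - l := by
      rw [Finset.card_sdiff_of_subset (Finset.mem_powersetCard.1 hY).1,
        (Finset.mem_powersetCard.1 hY).2]
    rw [Finset.card_sigma, ← hY', ← Finset.card_powersetCard, ← smul_eq_mul, ← Finset.sum_const]
    refine Finset.sum_congr rfl fun Z hZ => ?_
    rw [Finset.card_product, Finset.card_product, (Finset.mem_powersetCard.1 hX).2,
      (Finset.mem_powersetCard.1 hY).2, (Finset.mem_powersetCard.1 hZ).2]
  rw [← hS]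
  refine Finset.card_le_card_of_injOn
    (fun t => ⟨t.1, t.2.1, t.2.2.1, t.2.2.2.1, t.2.2.2.2.1, t.2.2.2.2.2⟩) ?_ ?_
  · intro t ht
    obtain ⟨⟨h1, h2, h3⟩, ⟨d1, d2, d3⟩, h4⟩ := hA t ht
    simp only [S, Finset.coe_sigma, Set.mem_sigma_iff, Finset.mem_coe,
      Finset.mem_powersetCard, Finset.mem_product]
    refine ⟨⟨Finset.subset_univ _, h1⟩, ⟨?_, h2⟩, ⟨?_, h3⟩, h4⟩
    · exact Finset.subset_compl_iff_disjoint_left.2 d1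
    · exact Finset.subset_sdiff.2 ⟨Finset.subset_compl_iff_disjoint_left.2 d2, d3.symm⟩
  · rintro ⟨a, b, c, d, e, f⟩ - ⟨a', b', c', d', e', f'⟩ - h
    simpa using h

theorem choose_mul_choose_mul_choose {n k l m : ℕ} (h : k + l + m ≤ n) :
    ((n.choose k : ℝ) * (n - k).choose l) * (n - k - l).choose m =
      n.factorial / (k.factorial * l.factorial * m.factorial * (n - (k + l + m)).factorial) := by
  have h1 := Nat.choose_mul_factorial_mul_factorial (n := n) (k := k) (by omega)
  have h2 := Nat.choose_mul_factorial_mul_factorial (n := n - k) (k := l) (by omega)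
  have h3 := Nat.choose_mul_factorial_mul_factorial (n := n - k - l) (k := m) (by omega)
  rw [show n - k - l - m = n - (k + l + m) by omega] at h3
  rw [eq_div_iff (by positivity), ← h1, ← h2, ← h3]
  push_cast
  ring

/-- An upper bound for the expected number of special tuples, with `q = 1 - p`. -/
noncomputable def tripleBound (q : ℝ) (n k l m : ℕ) : ℝ :=
  n.factorial / (k.factorial * l.factorial * m.factorial * (n - (k + l + m)).factorial) *
    (k * l * m) * (q ^ (k * l + k * m + l * m) / q ^ 3) *
    ((1 - q ^ k) * (1 - q ^ l) * (1 - q ^ m)) ^ (n - (k + l + m))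

theorem expX_le_tripleBound {n : ℕ} {p : ℝ} (h0 : 0 ≤ p) (h1 : p < 1) {k l m : ℕ}
    (hk : 1 ≤ k) (hl : 1 ≤ l) (hm : 1 ≤ m) (h : k + l + m ≤ n) :
    expX n p k l m ≤ tripleBound (1 - p) n k l m := by
  classical
  let A : Finset (Finset (Fin n) × Finset (Fin n) × Finset (Fin n) × Fin n × Fin n × Fin n) :=
    Finset.univ.filter fun t =>
    (t.1.card = k ∧ t.2.1.card = l ∧ t.2.2.1.card = m) ∧
      (Disjoint t.1 t.2.1 ∧ Disjoint t.1 t.2.2.1 ∧ Disjoint t.2.1 t.2.2.1) ∧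
      t.2.2.2.1 ∈ t.1 ∧ t.2.2.2.2.1 ∈ t.2.1 ∧ t.2.2.2.2.2 ∈ t.2.2.1
  have hq : 0 < 1 - p := by linarith
  set q := 1 - p with hqdef
  set B : ℝ := (q ^ (k * l + k * m + l * m) / q ^ 3) *
    ((1 - q ^ k) * (1 - q ^ l) * (1 - q ^ m)) ^ (n - (k + l + m)) with hB
  have hpow : ∀ a : ℕ, 0 ≤ 1 - q ^ a := fun a =>
    sub_nonneg.2 (pow_le_one₀ hq.le (by rw [hqdef]; linarith))
  have hB0 : 0 ≤ B := by
    have := hpow k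
    have := hpow l
    have := hpow m
    positivity
  have hcount : ∀ G : SimpleGraph (Fin n), (countX G k l m : ℝ) = ∑ t ∈ A,
      if SpecialTuple G t.1 t.2.1 t.2.2.1 t.2.2.2.1 t.2.2.2.2.1 t.2.2.2.2.2 then (1 : ℝ) else 0 := by
    intro G
    rw [Finset.sum_boole, countX, Nat.card_eq_fintype_card, Fintype.card_subtype,
      Finset.filter_filter]
    congr 2
    ext t
    rw [Finset.mem_filter_univ, Finset.mem_filter_univ, SpecialTuple]
    tauto
  rw [expX, integral_gnp_s7 h0 h1.le]
  simp only [hcount, Finset.mul_sum]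
  rw [Finset.sum_comm]
  have hterm : ∀ t ∈ A, ∑ G : SimpleGraph (Fin n),
      subsetWeight p (Finset.univ.filter fun e : Sym2 (Fin n) => ¬ e.IsDiag) G.edgeFinset *
        (if SpecialTuple G t.1 t.2.1 t.2.2.1 t.2.2.2.1 t.2.2.2.2.1 t.2.2.2.2.2
          then (1 : ℝ) else 0) ≤ B := by
    rintro ⟨X, Y, Z, x, y, z⟩ ht
    obtain ⟨⟨hX, hY, hZ⟩, ⟨d1, d2, d3⟩, hx, hy, hz⟩ := (Finset.mem_filter.1 ht).2
    dsimp only at hX hY hZ d1 d2 d3 hx hy hz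
    have key := sum_special_le h0 h1.le (X := ![X, Y, Z]) (x := ![x, y, z])
      (by
        rw [Finset.disjoint_left] at d1 d2 d3
        intro i j v hi hj
        fin_cases i <;> fin_cases j <;> first
          | rfl
          | exact absurd hj (d1 hi)
          | exact absurd hj (d2 hi)
          | exact absurd hj (d3 hi)
          | exact absurd hi (d1 hj)
          | exact absurd hi (d2 hj)
          | exact absurd hi (d3 hj))
      (by
        intro i
        fin_cases i
        exacts [hx, hy, hz])
    refine (le_trans (le_of_eq ?_) key).trans ?_
    · rfl
    · simp only [Fin.prod_univ_three]
      change p * (1 - p) ^ (X.card * Y.card - 1) * (p * (1 - p) ^ (Y.card * Z.card - 1)) *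
        (p * (1 - p) ^ (Z.card * X.card - 1)) *
        ((1 - (1 - p) ^ X.card) * (1 - (1 - p) ^ Y.card) * (1 - (1 - p) ^ Z.card)) ^
          (n - (X.card + Y.card + Z.card)) ≤ B
      rw [hX, hY, hZ, ← hqdef, hB]
      refine mul_le_mul_of_nonneg_right ?_ ?_
      · have e : ∀ a b : ℕ, 1 ≤ a → 1 ≤ b → q ^ (a * b - 1) = q ^ (a * b) / q := by
          intro a b ha hb
          rw [eq_div_iff hq.ne', ← pow_succ, Nat.sub_add_cancel (Nat.mul_pos ha hb)]
        rw [e k l hk hl, e l m hl hm, e m k hm hk]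
        have : p * (q ^ (k * l) / q) * (p * (q ^ (l * m) / q)) * (p * (q ^ (m * k) / q)) =
            p ^ 3 * (q ^ (k * l + k * m + l * m) / q ^ 3) := by
          rw [pow_add, pow_add, mul_comm m k]
          field_simp
        rw [this]
        exact mul_le_of_le_one_left (by positivity) (pow_le_one₀ h0 h1.le)
      · have := hpow k
        have := hpow l
        have := hpow m
        positivity
  refine (Finset.sum_le_card_nsmul A _ B hterm).trans ?_
  have hA := card_tuples_le n k l m A fun t ht => (Finset.mem_filter.1 ht).2
  have hA' : (A.card : ℝ) ≤ (n.choose k * (n - k).choose l) * (n - k - l).choose m *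
      (k * l * m) := by
    refine (Nat.cast_le.2 hA).trans (le_of_eq ?_)
    push_cast
    ring
  rw [choose_mul_choose_mul_choose h] at hA'
  rw [nsmul_eq_mul]
  refine (mul_le_mul_of_nonneg_right hA' hB0).trans (le_of_eq ?_)
  rw [tripleBound, hB]
  ring

theorem tripleBound_swap_left (q : ℝ) (n k l m : ℕ) :
    tripleBound q n k l m = tripleBound q n l k m := by
  simp only [tripleBound]
  rw [add_comm l k, show l * k + l * m + k * m = k * l + k * m + l * m by ring]
  ring

theorem tripleBound_swap_right (q : ℝ) (n k l m : ℕ) :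
    tripleBound q n k l m = tripleBound q n k m l := by
  simp only [tripleBound]
  rw [add_right_comm k m l, show k * m + k * l + m * l = k * l + k * m + l * m by ring]
  ring

theorem factorial_le_pow_mul_factorial {n s : ℕ} (h : s ≤ n) :
    (n.factorial : ℝ) ≤ (n : ℝ) ^ s * (n - s).factorial := by
  rw [← Nat.factorial_mul_descFactorial h, mul_comm]
  exact_mod_cast Nat.mul_le_mul_right _ (Nat.descFactorial_le_pow n s)

theorem tripleBound_le_exp {L : ℝ} (hL : 0 < L) {i N : ℝ} (hi : 0 ≤ i) {n k l m : ℕ}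
    (hn : (n : ℝ) ≤ Real.exp (L * N) * i) (h : k + l + m ≤ n) :
    tripleBound (Real.exp (-L)) n k l m ≤ Real.exp (3 * L) * (k * l * m) *
      Real.exp (3 * i - L * (k * l + k * m + l * m - N * (k + l + m))) *
      ((1 - Real.exp (-L) ^ k) * (1 - Real.exp (-L) ^ l) * (1 - Real.exp (-L) ^ m)) ^
        (n - (k + l + m)) := by
  have hpow : ∀ a : ℕ, 0 ≤ 1 - Real.exp (-L) ^ a := fun a =>
    sub_nonneg.2 (pow_le_one₀ (Real.exp_pos _).le (Real.exp_le_one_iff.2 (by linarith)))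
  have hk := hpow k
  have hl := hpow l
  have hm := hpow m
  rw [tripleBound]
  refine mul_le_mul_of_nonneg_right ?_ (by positivity)
  have hone : ∀ a : ℕ, (n : ℝ) ^ a / a.factorial ≤ Real.exp (L * N * a) * Real.exp i := by
    intro a
    calc (n : ℝ) ^ a / a.factorial ≤ (Real.exp (L * N) * i) ^ a / a.factorial := by gcongr
      _ = Real.exp (L * N * a) * (i ^ a / a.factorial) := by
        rw [mul_pow, ← Real.exp_nat_mul, mul_comm (a : ℝ), mul_div_assoc]
      _ ≤ _ := by
        gcongr
        exact Real.pow_div_factorial_le_exp i hi a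
  have hmult : (n.factorial : ℝ) / (k.factorial * l.factorial * m.factorial *
      (n - (k + l + m)).factorial) ≤ Real.exp (L * N * k) * Real.exp i *
        (Real.exp (L * N * l) * Real.exp i) * (Real.exp (L * N * m) * Real.exp i) := by
    calc _ ≤ ((n : ℝ) ^ (k + l + m) * (n - (k + l + m)).factorial) /
          (k.factorial * l.factorial * m.factorial * (n - (k + l + m)).factorial) := by
          gcongr
          exact factorial_le_pow_mul_factorial h
      _ = (n : ℝ) ^ k / k.factorial * ((n : ℝ) ^ l / l.factorial) *
          ((n : ℝ) ^ m / m.factorial) := by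
          rw [pow_add, pow_add]
          have := Nat.factorial_pos (n - (k + l + m))
          field_simp
      _ ≤ _ := by
        gcongr
        exacts [hone k, hone l, hone m]
  calc _ ≤ Real.exp (L * N * k) * Real.exp i *
        (Real.exp (L * N * l) * Real.exp i) * (Real.exp (L * N * m) * Real.exp i) *
        (k * l * m) * (Real.exp (-L) ^ (k * l + k * m + l * m) / Real.exp (-L) ^ 3) := by gcongr
    _ = _ := by
      rw [← Real.exp_nat_mul, ← Real.exp_nat_mul, ← Real.exp_sub]
      simp only [← Real.exp_add, mul_right_comm _ (_ * _ * (m : ℝ)) (Real.exp _)]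
      congr 2
      push_cast
      ring

theorem tripleBound_le_pow {q : ℝ} (h0 : 0 < q) (h1 : q < 1) {n k l m : ℕ} (hl : 1 ≤ l)
    (h : k + l + m ≤ n) :
    tripleBound q n k l m ≤ (n : ℝ) ^ 3 / q ^ 3 * (n : ℝ) ^ (l + m) *
      Real.exp (-((1 - q) * (n - (l + m)) * q ^ m)) := by
  have hpow : ∀ a : ℕ, 0 ≤ 1 - q ^ a := fun a => sub_nonneg.2 (pow_le_one₀ h0.le h1.le)
  have hk0 := hpow k
  have hl0 := hpow l
  have hm0 := hpow m
  have hmult : (n.factorial : ℝ) / (k.factorial * l.factorial * m.factorial *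
      (n - (k + l + m)).factorial) ≤ (n : ℝ) ^ (l + m) * (n - (l + m)).choose k := by
    have h1 := factorial_le_pow_mul_factorial (show l + m ≤ n by omega)
    have h2 := Nat.choose_mul_factorial_mul_factorial (show k ≤ n - (l + m) by omega)
    rw [show n - (l + m) - k = n - (k + l + m) by omega] at h2
    rw [div_le_iff₀ (by positivity)]
    refine h1.trans ?_
    rw [← h2]
    push_cast
    have hl1 : (1 : ℝ) ≤ l.factorial := by exact_mod_cast Nat.factorial_pos l
    have hm1 : (1 : ℝ) ≤ m.factorial := by exact_mod_cast Nat.factorial_pos m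
    calc _ = (n : ℝ) ^ (l + m) * ((n - (l + m)).choose k) *
          (k.factorial * 1 * 1 * (n - (k + l + m)).factorial) := by ring
      _ ≤ _ := by gcongr
  have hbin : ((n - (l + m)).choose k : ℝ) * (q ^ (l + m)) ^ k *
      ((1 - q ^ l) * (1 - q ^ m)) ^ (n - (k + l + m)) ≤
        Real.exp (-((1 - q) * (n - (l + m)) * q ^ m)) := by
    calc _ ≤ (q ^ (l + m) + (1 - q ^ l) * (1 - q ^ m)) ^ (n - (l + m)) := by
          rw [add_pow, show n - (k + l + m) = n - (l + m) - k by omega]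
          refine le_trans (le_of_eq ?_) (Finset.single_le_sum
            (f := fun a => (q ^ (l + m)) ^ a * ((1 - q ^ l) * (1 - q ^ m)) ^ (n - (l + m) - a) *
              ((n - (l + m)).choose a : ℝ))
            (fun a _ => by positivity) (Finset.mem_range.2 (show k < n - (l + m) + 1 by omega)))
          ring
      _ ≤ Real.exp (-((1 - q) * q ^ m)) ^ (n - (l + m)) := by
          refine pow_le_pow_left₀ (by positivity) ?_ _
          have := Real.add_one_le_exp (-((1 - q) * q ^ m))
          have h2 : q ^ l ≤ q := by
            simpa using pow_le_pow_of_le_one h0.le h1.le hl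
          have h3 : 0 < q ^ m := pow_pos h0 m
          have h4 : 0 < q ^ l := pow_pos h0 l
          rw [pow_add]
          nlinarith [mul_nonneg h4.le hm0, mul_nonneg h3.le (sub_nonneg.2 h2)]
      _ = _ := by
          rw [← Real.exp_nat_mul, Nat.cast_sub (by omega)]
          push_cast
          ring_nf
  have hklm : (k : ℝ) * l * m ≤ (n : ℝ) ^ 3 := by
    have : (k : ℝ) ≤ n := by exact_mod_cast (by omega)
    have : (l : ℝ) ≤ n := by exact_mod_cast (by omega)
    have : (m : ℝ) ≤ n := by exact_mod_cast (by omega)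
    calc (k : ℝ) * l * m ≤ n * n * n := by gcongr
      _ = _ := by ring
  have hrest : (1 - q ^ k) ^ (n - (k + l + m)) ≤ 1 :=
    pow_le_one₀ hk0 (by linarith [pow_pos h0 k])
  have hlm : q ^ (l * m) ≤ 1 := pow_le_one₀ h0.le h1.le
  rw [tripleBound]
  calc _ ≤ (n : ℝ) ^ (l + m) * (n - (l + m)).choose k * n ^ 3 *
        (q ^ (k * l + k * m + l * m) / q ^ 3) *
        ((1 - q ^ k) * (1 - q ^ l) * (1 - q ^ m)) ^ (n - (k + l + m)) := by gcongr
    _ = (n : ℝ) ^ 3 / q ^ 3 * (n : ℝ) ^ (l + m) * (((n - (l + m)).choose k : ℝ) *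
        (q ^ (l + m)) ^ k * ((1 - q ^ l) * (1 - q ^ m)) ^ (n - (k + l + m))) *
        (q ^ (l * m) * (1 - q ^ k) ^ (n - (k + l + m))) := by
      rw [mul_assoc (1 - q ^ k), mul_pow (1 - q ^ k), ← pow_mul, pow_add,
        show k * l + k * m = (l + m) * k by ring]
      ring
    _ ≤ (n : ℝ) ^ 3 / q ^ 3 * (n : ℝ) ^ (l + m) *
        Real.exp (-((1 - q) * (n - (l + m)) * q ^ m)) * (1 * 1) := by gcongr
    _ = _ := by ring

theorem exists_mul_abs_le_exp_neg_sub {h : ℝ} (hh : 0 < h) :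
    ∃ c > 0, ∀ x, h ≤ |x| → c * |x| ≤ Real.exp (-x) - 1 + x := by
  have h1 : 0 < Real.exp (-h) - 1 + h := by
    have := Real.add_one_lt_exp (x := -h) (by linarith)
    linarith
  have h2 : 0 < Real.exp h - 1 - h := by
    have := Real.add_one_lt_exp (x := h) (by linarith)
    linarith
  have h3 : Real.exp (-h) < 1 := by simpa using hh
  have h4 : 1 < Real.exp h := Real.one_lt_exp_iff.2 hh
  refine ⟨min (min ((Real.exp (-h) - 1 + h) / h) ((Real.exp h - 1 - h) / h))
    (min (1 - Real.exp (-h)) (Real.exp h - 1)), ?_, ?_⟩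
  · refine lt_min (lt_min (by positivity) (by positivity)) (lt_min ?_ ?_) <;> linarith
  · intro x hx
    set c := min (min ((Real.exp (-h) - 1 + h) / h) ((Real.exp h - 1 - h) / h))
      (min (1 - Real.exp (-h)) (Real.exp h - 1))
    have c1 : c * h ≤ Real.exp (-h) - 1 + h := by
      rw [← le_div_iff₀ hh]
      exact (min_le_left _ _).trans (min_le_left _ _)
    have c2 : c * h ≤ Real.exp h - 1 - h := by
      rw [← le_div_iff₀ hh]
      exact (min_le_left _ _).trans (min_le_right _ _)
    have c3 : c ≤ 1 - Real.exp (-h) := (min_le_right _ _).trans (min_le_left _ _)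
    have c4 : c ≤ Real.exp h - 1 := (min_le_right _ _).trans (min_le_right _ _)
    rcases le_total 0 x with h0 | h0
    · rw [abs_of_nonneg h0] at hx ⊢
      have ht : Real.exp (-h) * (1 - (x - h)) ≤ Real.exp (-x) := by
        have := Real.add_one_le_exp (-(x - h))
        calc Real.exp (-h) * (1 - (x - h)) ≤ Real.exp (-h) * Real.exp (-(x - h)) := by
              gcongr
              linarith
          _ = _ := by rw [← Real.exp_add]; ring_nf
      nlinarith
    · rw [abs_of_nonpos h0] at hx ⊢
      have ht : Real.exp h * (1 + (-x - h)) ≤ Real.exp (-x) := by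
        have := Real.add_one_le_exp (-x - h)
        calc Real.exp h * (1 + (-x - h)) ≤ Real.exp h * Real.exp (-x - h) := by
              gcongr
              linarith
          _ = _ := by rw [← Real.exp_add]; ring_nf
      nlinarith

theorem neg_mul_abs_add_abs_le_mul {t a b : ℝ} (ht : 0 ≤ t) (ha : -t ≤ a) (hb : -t ≤ b) :
    -(t * (|a| + |b|)) ≤ a * b := by
  rcases abs_cases a with ⟨h1, h2⟩ | ⟨h1, h2⟩ <;> rcases abs_cases b with ⟨h3, h4⟩ | ⟨h3, h4⟩ <;>
    rw [h1, h3] <;> nlinarith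

theorem window_exponent_le {L c ε i a b d : ℝ} (hL : 0 < L) (hc : 0 < c)
    (hψ : ∀ x, L / 2 ≤ |x| → c * |x| ≤ Real.exp (-x) - 1 + x) (hε : 0 < ε) (hεc : 12 * ε ≤ c)
    (hεi : 1 / 2 ≤ ε * i) (ha : -(2 * (ε * i)) ≤ a) (hb : -(2 * (ε * i)) ≤ b)
    (hd : -(2 * (ε * i)) ≤ d) (ha' : 1 / 2 ≤ |a|) (hb' : 1 / 2 ≤ |b|) (hd' : 1 / 2 ≤ |d|) :
    3 * i - L * ((i + 1 / 2) * (a + b + d) + (a * b + a * d + b * d)) -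
      i * (Real.exp (-(L * a)) + Real.exp (-(L * b)) + Real.exp (-(L * d))) ≤
      -(3 / 4 * c * L * i) := by
  have hi : 0 < i := (pos_iff_pos_of_mul_pos (by linarith)).1 hε
  have h1 := neg_mul_abs_add_abs_le_mul (by linarith) ha hb
  have h2 := neg_mul_abs_add_abs_le_mul (by linarith) ha hd
  have h3 := neg_mul_abs_add_abs_le_mul (by linarith) hb hd
  have hone : ∀ x : ℝ, 1 / 2 ≤ |x| →
      1 - L * x + 5 * L * ε * |x| - Real.exp (-(L * x)) ≤ -(1 / 4 * c * L) := by
    intro x hx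
    have := hψ (L * x) (by rw [abs_mul, abs_of_pos hL]; nlinarith)
    rw [abs_mul, abs_of_pos hL] at this
    have hLx : 1 / 2 * L ≤ L * |x| := by nlinarith
    nlinarith [mul_le_mul_of_nonneg_right hεc (by positivity : 0 ≤ L * |x|),
      mul_le_mul_of_nonneg_left hLx hc.le]
  have habs : ∀ x : ℝ, -(ε * i * |x|) ≤ 1 / 2 * x := by
    intro x
    nlinarith [neg_abs_le x, abs_nonneg x]
  have hE : i * (a + b + d) - 5 * (ε * i) * (|a| + |b| + |d|) ≤
      (i + 1 / 2) * (a + b + d) + (a * b + a * d + b * d) := by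
    linarith [habs a, habs b, habs d]
  nlinarith [mul_le_mul_of_nonneg_left hE hL.le, mul_le_mul_of_nonneg_left (hone a ha') hi.le,
    mul_le_mul_of_nonneg_left (hone b hb') hi.le, mul_le_mul_of_nonneg_left (hone d hd') hi.le]

theorem half_le_abs_sub_add_half (k i : ℕ) : (1 : ℝ) / 2 ≤ |(k : ℝ) - (i + 1 / 2)| := by
  rcases le_or_gt k i with h | h
  · have : (k : ℝ) ≤ i := by exact_mod_cast h
    exact le_trans (by linarith) (neg_le_abs _)
  · have : (i : ℝ) + 1 ≤ k := by exact_mod_cast h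
    exact le_trans (by linarith) (le_abs_self _)

theorem one_sub_pow_prod_le_one {q : ℝ} (h0 : 0 ≤ q) (h1 : q ≤ 1) (k l m r : ℕ) :
    ((1 - q ^ k) * (1 - q ^ l) * (1 - q ^ m)) ^ r ≤ 1 := by
  have hpow : ∀ a : ℕ, 0 ≤ 1 - q ^ a := fun a => sub_nonneg.2 (pow_le_one₀ h0 h1)
  have hle : ∀ a : ℕ, 1 - q ^ a ≤ 1 := fun a => by linarith [pow_nonneg h0 a]
  have := hpow k
  have := hpow l
  have := hpow m
  exact pow_le_one₀ (by positivity)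
    (mul_le_one₀ (mul_le_one₀ (hle k) (hpow l) (hle l)) (hpow m) (hle m))

theorem tripleBound_le_of_exponent {L : ℝ} (hL : 0 < L) {i n k l m : ℕ}
    (hn : (n : ℝ) ≤ Real.exp (L * (i + 1 / 2)) * i) (h : k + l + m ≤ n)
    (hE : (i : ℝ) ^ 2 ≤ k * l + k * m + l * m - (i + 1 / 2) * (k + l + m)) :
    tripleBound (Real.exp (-L)) n k l m ≤
      Real.exp (3 * L) * (n : ℝ) ^ 3 * Real.exp (3 * i - L * (i : ℝ) ^ 2) := by
  have hklm : (k : ℝ) * l * m ≤ (n : ℝ) ^ 3 := by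
    have : (k : ℝ) ≤ n := by exact_mod_cast (by omega)
    have : (l : ℝ) ≤ n := by exact_mod_cast (by omega)
    have : (m : ℝ) ≤ n := by exact_mod_cast (by omega)
    calc (k : ℝ) * l * m ≤ n * n * n := by gcongr
      _ = _ := by ring
  refine (tripleBound_le_exp hL (Nat.cast_nonneg i) hn h).trans ?_
  refine (mul_le_of_le_one_right (by positivity) (one_sub_pow_prod_le_one (Real.exp_pos _).le
    (Real.exp_le_one_iff.2 (by linarith)) _ _ _ _)).trans ?_
  gcongr

theorem tripleBound_le_of_small {L ε : ℝ} (hL : 0 < L) {i n k l m : ℕ} (hi : 1 ≤ i)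
    (hn' : Real.exp (L * (i + 1 / 2)) * i < n + 1) (h : k + l + m ≤ n) (hl : 1 ≤ l)
    (hl4 : l < 4 * i) (hml : m ≤ l) (hm : (m : ℝ) ≤ (1 - ε) * i) :
    tripleBound (Real.exp (-L)) n k l m ≤ Real.exp (3 * L) * (n : ℝ) ^ 3 * ((n : ℝ) ^ (8 * i) *
      Real.exp ((1 - Real.exp (-L)) * (1 + 8 * i - Real.exp (L * ε * i)))) := by
  have hp : 0 < 1 - Real.exp (-L) := by simpa using hL
  have hi' : (1 : ℝ) ≤ i := by exact_mod_cast hi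
  refine (tripleBound_le_pow (Real.exp_pos _) (by linarith) hl h).trans ?_
  have hn1 : (1 : ℝ) ≤ n := by exact_mod_cast (by omega)
  rw [mul_assoc]
  gcongr ?_ * (?_ * Real.exp ?_)
  · rw [div_eq_mul_inv, ← Real.exp_nat_mul, ← Real.exp_neg, mul_comm]
    refine le_of_eq ?_
    congr 2
    push_cast
    ring
  · exact pow_le_pow_right₀ hn1 (by omega)
  · rw [mul_assoc, ← mul_neg]
    refine mul_le_mul_of_nonneg_left ?_ hp.le
    have hl4' : (l : ℝ) ≤ 4 * i := by exact_mod_cast hl4.le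
    have hml' : (m : ℝ) ≤ l := by exact_mod_cast hml
    have hqm : Real.exp (-L) ^ m = Real.exp (-(L * m)) := by
      rw [← Real.exp_nat_mul]
      ring_nf
    have hqm1 : Real.exp (-(L * m)) ≤ 1 := Real.exp_le_one_iff.2 (by
      have : (0 : ℝ) ≤ L * m := by positivity
      linarith)
    have hmain : Real.exp (L * ε * i) ≤ Real.exp (L * (i + 1 / 2)) * i * Real.exp (-(L * m)) := by
      calc Real.exp (L * ε * i) ≤ Real.exp (L * (i + 1 / 2) + -(L * m)) := by
            gcongr
            nlinarith [mul_le_mul_of_nonneg_left hm hL.le]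
        _ = Real.exp (L * (i + 1 / 2)) * 1 * Real.exp (-(L * m)) := by rw [Real.exp_add, mul_one]
        _ ≤ _ := by gcongr
    rw [hqm]
    have hpos := Real.exp_pos (-(L * m))
    have h2 : Real.exp (L * (i + 1 / 2)) * i * Real.exp (-(L * m)) ≤
        (n + 1) * Real.exp (-(L * m)) := by gcongr
    have h3 : (1 + (l + m)) * Real.exp (-(L * m)) ≤ 1 + 8 * i := by
      calc (1 + (l + m)) * Real.exp (-(L * m)) ≤ (1 + (l + m : ℝ)) * 1 := by gcongr
        _ ≤ _ := by linarith
    linarith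

theorem tripleBound_le_of_window {L c ε : ℝ} (hL : 0 < L) (hc : 0 < c)
    (hψ : ∀ x, L / 2 ≤ |x| → c * |x| ≤ Real.exp (-x) - 1 + x) (hε : 0 < ε) (hεc : 12 * ε ≤ c)
    {i n k l m : ℕ} (hεi : 1 / 2 ≤ ε * i)
    (herr : 3 * (1 + 12 * i) * Real.exp (-(L * ((1 - ε) * i))) ≤ 1)
    (hn : (n : ℝ) ≤ Real.exp (L * (i + 1 / 2)) * i)
    (hn' : Real.exp (L * (i + 1 / 2)) * i < n + 1) (h : k + l + m ≤ n)
    (hk : (1 - ε) * i ≤ k) (hl : (1 - ε) * i ≤ l) (hm : (1 - ε) * i ≤ m)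
    (hk4 : k < 4 * i) (hl4 : l < 4 * i) (hm4 : m < 4 * i) :
    tripleBound (Real.exp (-L)) n k l m ≤
      Real.exp (3 * L) * (4 * i) ^ 3 * Real.exp (1 - 3 / 4 * c * L * i) := by
  refine (tripleBound_le_exp hL (Nat.cast_nonneg i) hn h).trans ?_
  have hk4' : (k : ℝ) ≤ 4 * i := by exact_mod_cast hk4.le
  have hl4' : (l : ℝ) ≤ 4 * i := by exact_mod_cast hl4.le
  have hm4' : (m : ℝ) ≤ 4 * i := by exact_mod_cast hm4.le
  have hq1 : Real.exp (-L) ≤ 1 := Real.exp_le_one_iff.2 (by linarith)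
  have hpow : ∀ a : ℕ, 0 ≤ 1 - Real.exp (-L) ^ a := fun a =>
    sub_nonneg.2 (pow_le_one₀ (Real.exp_pos _).le hq1)
  set r := n - (k + l + m) with hr
  have hrc : (r : ℝ) = n - (k + l + m) := by
    rw [hr, Nat.cast_sub h]
    push_cast
    ring
  have hone : ∀ a : ℕ, (1 - ε) * i ≤ a → (1 - Real.exp (-L) ^ a) ^ r ≤
      Real.exp (1 / 3 - i * Real.exp (-(L * (a - (i + 1 / 2))))) := by
    intro a ha
    have hqa : Real.exp (-L) ^ a = Real.exp (-(L * a)) := by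
      rw [← Real.exp_nat_mul]
      ring_nf
    have h1 : 1 - Real.exp (-L) ^ a ≤ Real.exp (-Real.exp (-(L * a))) := by
      rw [hqa]
      have := Real.add_one_le_exp (-Real.exp (-(L * a)))
      linarith
    refine (pow_le_pow_left₀ (hpow a) h1 r).trans ?_
    rw [← Real.exp_nat_mul, Real.exp_le_exp, hrc]
    have hpos := Real.exp_pos (-(L * a))
    have h2 : Real.exp (-(L * a)) ≤ Real.exp (-(L * ((1 - ε) * i))) := by gcongr
    have h3 : i * Real.exp (-(L * (a - (i + 1 / 2)))) =
        Real.exp (L * (i + 1 / 2)) * i * Real.exp (-(L * a)) := by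
      rw [mul_comm (Real.exp _) (i : ℝ), mul_assoc, ← Real.exp_add]
      ring_nf
    have h4 : Real.exp (L * (i + 1 / 2)) * i * Real.exp (-(L * a)) ≤
        (n + 1) * Real.exp (-(L * a)) := by gcongr
    have h5 : (1 + (k + l + m)) * Real.exp (-(L * a)) ≤
        (1 + 12 * i) * Real.exp (-(L * ((1 - ε) * i))) := by
      gcongr
      linarith
    linarith
  have hR : ((1 - Real.exp (-L) ^ k) * (1 - Real.exp (-L) ^ l) * (1 - Real.exp (-L) ^ m)) ^ r ≤
      Real.exp (1 - i * (Real.exp (-(L * (k - (i + 1 / 2)))) +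
        Real.exp (-(L * (l - (i + 1 / 2)))) + Real.exp (-(L * (m - (i + 1 / 2)))))) := by
    have := hpow k
    have := hpow l
    have := hpow m
    rw [mul_pow, mul_pow]
    refine (mul_le_mul (mul_le_mul (hone k hk) (hone l hl) (by positivity) (by positivity))
      (hone m hm) (by positivity) (by positivity)).trans (le_of_eq ?_)
    rw [← Real.exp_add, ← Real.exp_add]
    ring_nf
  have hwin := window_exponent_le (i := (i : ℝ)) (a := k - (i + 1 / 2)) (b := l - (i + 1 / 2))
    (d := m - (i + 1 / 2)) hL hc hψ hε hεc hεi (by linarith) (by linarith) (by linarith)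
    (half_le_abs_sub_add_half k i) (half_le_abs_sub_add_half l i) (half_le_abs_sub_add_half m i)
  calc _ ≤ Real.exp (3 * L) * (4 * i * (4 * i) * (4 * i)) *
        Real.exp (3 * i - L * (k * l + k * m + l * m - (i + 1 / 2) * (k + l + m))) *
        Real.exp (1 - i * (Real.exp (-(L * (k - (i + 1 / 2)))) +
          Real.exp (-(L * (l - (i + 1 / 2)))) + Real.exp (-(L * (m - (i + 1 / 2)))))) := by
        have := hpow k
        have := hpow l
        have := hpow m
        gcongr
    _ ≤ _ := by
        rw [mul_assoc, ← Real.exp_add, show (4 * i * (4 * i) * (4 * i) : ℝ) = (4 * i) ^ 3 by ring]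
        gcongr
        linear_combination hwin

/-- The bound for the triples that are not all of order `i`. -/
noncomputable def tailBound (L ε : ℝ) (n i : ℕ) : ℝ :=
  Real.exp (3 * L) * (n : ℝ) ^ 3 * (Real.exp (3 * i - L * (i : ℝ) ^ 2) + (n : ℝ) ^ (8 * i) *
    Real.exp ((1 - Real.exp (-L)) * (1 + 8 * i - Real.exp (L * ε * i))))

/-- The bound for the triples that are all of order `i`. -/
noncomputable def windowBound (L c : ℝ) (i : ℕ) : ℝ :=
  Real.exp (3 * L) * (4 * i) ^ 3 * Real.exp (1 - 3 / 4 * c * L * i)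

theorem tripleBound_le_of_sorted {L c ε : ℝ} (hL : 0 < L) (hc : 0 < c)
    (hψ : ∀ x, L / 2 ≤ |x| → c * |x| ≤ Real.exp (-x) - 1 + x) (hε : 0 < ε) (hεc : 12 * ε ≤ c)
    (hε16 : ε ≤ 1 / 16) {i n k l m : ℕ} (hεi : 1 / 2 ≤ ε * i)
    (herr : 3 * (1 + 12 * i) * Real.exp (-(L * ((1 - ε) * i))) ≤ 1)
    (hn : (n : ℝ) ≤ Real.exp (L * (i + 1 / 2)) * i)
    (hn' : Real.exp (L * (i + 1 / 2)) * i < n + 1) (h : k + l + m ≤ n)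
    (hm : 1 ≤ m) (hml : m ≤ l) (hlk : l ≤ k) :
    tripleBound (Real.exp (-L)) n k l m ≤ tailBound L ε n i +
      if k < 4 * i ∧ l < 4 * i ∧ m < 4 * i then windowBound L c i else 0 := by
  have hi8 : (8 : ℝ) ≤ i := by nlinarith
  have hw : 0 ≤ if k < 4 * i ∧ l < 4 * i ∧ m < 4 * i then windowBound L c i else 0 := by
    split_ifs
    · exact mul_nonneg (by positivity) (Real.exp_pos _).le
    · exact le_rfl
  have hml' : (m : ℝ) ≤ l := by exact_mod_cast hml
  have hlk' : (l : ℝ) ≤ k := by exact_mod_cast hlk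
  have hm' : (1 : ℝ) ≤ m := by exact_mod_cast hm
  have hdense : (i : ℝ) ^ 2 ≤ k * l + k * m + l * m - (i + 1 / 2) * (k + l + m) →
      tripleBound (Real.exp (-L)) n k l m ≤ tailBound L ε n i +
        if k < 4 * i ∧ l < 4 * i ∧ m < 4 * i then windowBound L c i else 0 := by
    intro hE
    refine (tripleBound_le_of_exponent hL hn h hE).trans (le_trans ?_ (le_add_of_nonneg_right hw))
    rw [tailBound]
    gcongr
    exact le_add_of_nonneg_right (by positivity)
  rcases le_or_gt (4 * i) l with hl4 | hl4
  · have hl4' : (4 : ℝ) * i ≤ l := by exact_mod_cast hl4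
    apply hdense
    nlinarith [mul_le_mul_of_nonneg_right hl4' (by linarith : (0 : ℝ) ≤ k)]
  rcases le_or_gt (m : ℝ) ((1 - ε) * i) with hmε | hmε
  · refine (tripleBound_le_of_small hL (by exact_mod_cast (by linarith : (1 : ℝ) ≤ i)) hn' h
      (hm.trans hml) hl4 hml hmε).trans (le_trans ?_ (le_add_of_nonneg_right hw))
    rw [tailBound]
    gcongr
    exact le_add_of_nonneg_left (by positivity)
  rcases le_or_gt (4 * i) k with hk4 | hk4
  · have hk4' : (4 : ℝ) * i ≤ k := by exact_mod_cast hk4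
    have hm15 : 15 / 16 * (i : ℝ) ≤ m := by nlinarith
    apply hdense
    nlinarith [mul_nonneg (sub_nonneg.2 hk4') (by linarith : (0 : ℝ) ≤ l + m - (i + 1 / 2)),
      mul_nonneg (by linarith : (0 : ℝ) ≤ l - 15 / 16 * i)
        (by linarith : (0 : ℝ) ≤ 4 * i + m - (i + 1 / 2)),
      mul_nonneg (by linarith : (0 : ℝ) ≤ m - 15 / 16 * i)
        (by linarith : (0 : ℝ) ≤ 4 * i + 15 / 16 * i - (i + 1 / 2))]
  · rw [if_pos ⟨hk4, hl4, hml.trans_lt hl4⟩]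
    refine (tripleBound_le_of_window hL hc hψ hε hεc hεi herr hn hn' h (by linarith) (by linarith)
      hmε.le hk4 hl4 (hml.trans_lt hl4)).trans (le_add_of_nonneg_left ?_)
    rw [tailBound]
    positivity

theorem tripleBound_le {L c ε : ℝ} (hL : 0 < L) (hc : 0 < c)
    (hψ : ∀ x, L / 2 ≤ |x| → c * |x| ≤ Real.exp (-x) - 1 + x) (hε : 0 < ε) (hεc : 12 * ε ≤ c)
    (hε16 : ε ≤ 1 / 16) {i n k l m : ℕ} (hεi : 1 / 2 ≤ ε * i)
    (herr : 3 * (1 + 12 * i) * Real.exp (-(L * ((1 - ε) * i))) ≤ 1)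
    (hn : (n : ℝ) ≤ Real.exp (L * (i + 1 / 2)) * i)
    (hn' : Real.exp (L * (i + 1 / 2)) * i < n + 1) (h : k + l + m ≤ n)
    (hk : 1 ≤ k) (hl : 1 ≤ l) (hm : 1 ≤ m) :
    tripleBound (Real.exp (-L)) n k l m ≤ tailBound L ε n i +
      if k < 4 * i ∧ l < 4 * i ∧ m < 4 * i then windowBound L c i else 0 := by
  have hs := fun k l m h => tripleBound_le_of_sorted (k := k) (l := l) (m := m)
    hL hc hψ hε hεc hε16 hεi herr hn hn' h
  rcases le_total k l with h1 | h1 <;> rcases le_total l m with h2 | h2 <;>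
    rcases le_total k m with h3 | h3
  · have := hs m l k (by omega) hk h1 h2
    rw [tripleBound_swap_left, tripleBound_swap_right, tripleBound_swap_left]
    convert this using 3
    tauto
  · have := hs m l k (by omega) hk h1 h2
    rw [tripleBound_swap_left, tripleBound_swap_right, tripleBound_swap_left]
    convert this using 3
    tauto
  · have := hs l m k (by omega) hk h3 h2
    rw [tripleBound_swap_left, tripleBound_swap_right]
    convert this using 3
    tauto
  · have := hs l k m (by omega) hm h3 h1
    rw [tripleBound_swap_left]
    convert this using 3
    tauto
  · have := hs m k l (by omega) hl h1 h3
    rw [tripleBound_swap_right, tripleBound_swap_left]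
    convert this using 3
    tauto
  · have := hs k m l (by omega) hl h2 h3
    rw [tripleBound_swap_right]
    convert this using 3
    tauto
  · exact hs k l m h hm h2 h1
  · exact hs k l m h hm h2 h1

theorem tendsto_pow_mul_exp_neg_mul_nat {δ : ℝ} (hδ : 0 < δ) (d : ℕ) :
    Tendsto (fun i : ℕ => (i : ℝ) ^ d * Real.exp (-(δ * i))) atTop (nhds 0) := by
  have h := ((Real.tendsto_pow_mul_exp_neg_atTop_nhds_zero d).comp
    (tendsto_natCast_atTop_atTop.const_mul_atTop hδ)).const_mul (1 / δ ^ d)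
  rw [mul_zero] at h
  refine h.congr fun i => ?_
  simp only [Function.comp_apply, mul_pow]
  field_simp

theorem tendsto_linear_sub_sq_atBot (a : ℝ) {b : ℝ} (hb : 0 < b) :
    Tendsto (fun i : ℕ => a * i - b * (i : ℝ) ^ 2) atTop atBot := by
  have h1 : Tendsto (fun i : ℕ => a - b * (i : ℝ)) atTop atBot := by
    have := tendsto_natCast_atTop_atTop (R := ℝ) |>.const_mul_atTop hb
    simpa [sub_eq_add_neg] using tendsto_atBot_add_const_left _ a (tendsto_neg_atTop_atBot.comp this)
  refine (tendsto_natCast_atTop_atTop.atTop_mul_atBot₀ h1).congr fun i => ?_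
  ring

theorem tendsto_quadratic_sub_exp_atBot (a b c : ℝ) {d s : ℝ} (hd : 0 < d) (hs : 0 < s) :
    Tendsto (fun i : ℕ => a + b * i + c * (i : ℝ) ^ 2 - d * Real.exp (s * i)) atTop atBot := by
  have h1 := (tendsto_linear_sub_sq_atBot (|a| + |b| + |c|)
    (b := d * (s ^ 3 / 6)) (by positivity))
  refine tendsto_atBot_mono' _ ?_ (tendsto_natCast_atTop_atTop.atTop_mul_atBot₀ h1)
  filter_upwards [eventually_ge_atTop 1] with i hi
  have hi' : (1 : ℝ) ≤ i := by exact_mod_cast hi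
  have he := Real.pow_div_factorial_le_exp (s * i) (by positivity) 3
  have ha : a ≤ |a| * (i : ℝ) ^ 2 :=
    (le_abs_self a).trans (le_mul_of_one_le_right (abs_nonneg _) (one_le_pow₀ hi'))
  have hb : b * i ≤ |b| * (i : ℝ) ^ 2 := by
    calc b * i ≤ |b| * i := by gcongr; exact le_abs_self b
      _ ≤ |b| * (i : ℝ) ^ 2 := by
        gcongr
        exact le_self_pow₀ hi' (by norm_num)
  have hc : c * (i : ℝ) ^ 2 ≤ |c| * (i : ℝ) ^ 2 := by gcongr; exact le_abs_self c
  have he' : d * (s ^ 3 / 6) * (i : ℝ) ^ 3 ≤ d * Real.exp (s * i) := by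
    rw [mul_assoc]
    refine mul_le_mul_of_nonneg_left (le_trans (le_of_eq ?_) he) hd.le
    norm_num [Nat.factorial]
    ring
  linarith

theorem tendsto_tailBound {L ε : ℝ} (hL : 0 < L) (hε : 0 < ε) {n : ℕ → ℕ}
    (hn : ∀ i : ℕ, (n i : ℝ) ≤ Real.exp (L * (i + 1 / 2)) * i) :
    Tendsto (fun i : ℕ => (n i : ℝ) ^ 3 * tailBound L ε (n i) i) atTop (nhds 0) := by
  set M := 3 / 2 * L + 1 with hM
  have hp : 0 < 1 - Real.exp (-L) := by simpa using hL
  have hnM : ∀ i : ℕ, 1 ≤ i → (n i : ℝ) ≤ Real.exp (M * i) := by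
    intro i hi
    have hi' : (1 : ℝ) ≤ i := by exact_mod_cast hi
    calc (n i : ℝ) ≤ Real.exp (L * (i + 1 / 2)) * i := hn i
      _ ≤ Real.exp (L * (i + 1 / 2)) * Real.exp i := by
        gcongr
        linarith [Real.add_one_le_exp (i : ℝ)]
      _ ≤ Real.exp (M * i) := by
        rw [← Real.exp_add, hM]
        gcongr
        nlinarith
  have h1 := Real.tendsto_exp_atBot.comp (tendsto_linear_sub_sq_atBot (6 * M + 3) hL)
  have h2 := Real.tendsto_exp_atBot.comp (tendsto_quadratic_sub_exp_atBot (1 - Real.exp (-L))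
    (6 * M + 8 * (1 - Real.exp (-L))) (8 * M) hp (mul_pos hL hε))
  have h3 := (h1.add h2).const_mul (Real.exp (3 * L))
  rw [add_zero, mul_zero] at h3
  refine squeeze_zero' (Eventually.of_forall fun i => ?_) ?_ h3
  · rw [tailBound]
    positivity
  · filter_upwards [eventually_ge_atTop 1] with i hi
    simp only [Function.comp_apply]
    have hni := hnM i hi
    rw [tailBound]
    calc (n i : ℝ) ^ 3 * (Real.exp (3 * L) * (n i : ℝ) ^ 3 * (Real.exp (3 * i - L * (i : ℝ) ^ 2) +
          (n i : ℝ) ^ (8 * i) *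
            Real.exp ((1 - Real.exp (-L)) * (1 + 8 * i - Real.exp (L * ε * i)))))
        ≤ Real.exp (M * i) ^ 3 * (Real.exp (3 * L) * Real.exp (M * i) ^ 3 *
          (Real.exp (3 * i - L * (i : ℝ) ^ 2) + Real.exp (M * i) ^ (8 * i) *
            Real.exp ((1 - Real.exp (-L)) * (1 + 8 * i - Real.exp (L * ε * i))))) := by gcongr
      _ = _ := by
        rw [← Real.exp_nat_mul, ← Real.exp_nat_mul, mul_add (Real.exp (3 * L)),
          mul_add (Real.exp (3 * L) * _), mul_add]
        simp only [← Real.exp_add]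
        congr 2 <;> push_cast <;> ring

theorem tendsto_windowBound {L c : ℝ} (hL : 0 < L) (hc : 0 < c) :
    Tendsto (fun i : ℕ => (4 * (i : ℝ)) ^ 3 * windowBound L c i) atTop (nhds 0) := by
  have h := (tendsto_pow_mul_exp_neg_mul_nat (show 0 < 3 / 4 * c * L by positivity) 6).const_mul
    (4 ^ 6 * Real.exp (3 * L + 1))
  rw [mul_zero] at h
  refine h.congr fun i => ?_
  rw [windowBound, sub_eq_add_neg, Real.exp_add, Real.exp_add]
  ring

theorem sum_Icc_triple_le (n t : ℕ) (f : ℕ → ℕ → ℕ → ℝ) {a b : ℝ} (hb : 0 ≤ b)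
    (hf : ∀ k ∈ Finset.Icc 1 n, ∀ l ∈ Finset.Icc 1 n, ∀ m ∈ Finset.Icc 1 n,
      f k l m ≤ a + if k < t ∧ l < t ∧ m < t then b else 0) :
    ∑ k ∈ Finset.Icc 1 n, ∑ l ∈ Finset.Icc 1 n, ∑ m ∈ Finset.Icc 1 n, f k l m ≤
      (n : ℝ) ^ 3 * a + (t : ℝ) ^ 3 * b := by
  set χ : ℕ → ℝ := fun k => if k < t then 1 else 0 with hχ
  have hsum : ∑ k ∈ Finset.Icc 1 n, χ k ≤ t := by
    rw [hχ, Finset.sum_boole]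
    have : ((Finset.Icc 1 n).filter (· < t)).card ≤ (Finset.range t).card :=
      Finset.card_le_card fun k hk => Finset.mem_range.2 (Finset.mem_filter.1 hk).2
    rw [Finset.card_range] at this
    exact_mod_cast this
  have hsum0 : 0 ≤ ∑ k ∈ Finset.Icc 1 n, χ k :=
    Finset.sum_nonneg fun k _ => by simp only [hχ]; split_ifs <;> norm_num
  calc _ ≤ ∑ k ∈ Finset.Icc 1 n, ∑ l ∈ Finset.Icc 1 n, ∑ m ∈ Finset.Icc 1 n,
        (a + χ k * (χ l * (χ m * b))) := by
        refine Finset.sum_le_sum fun k hk => Finset.sum_le_sum fun l hl =>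
          Finset.sum_le_sum fun m hm => (hf k hk l hl m hm).trans (le_of_eq ?_)
        simp only [hχ, ite_and, ite_mul, one_mul, zero_mul]
    _ = (n : ℝ) ^ 3 * a + (∑ k ∈ Finset.Icc 1 n, χ k) ^ 3 * b := by
        simp only [Finset.sum_add_distrib, ← Finset.mul_sum, ← Finset.sum_mul, Finset.sum_const,
          Nat.card_Icc, nsmul_eq_mul, Nat.add_sub_cancel]
        ring
    _ ≤ _ := by gcongr

theorem stmt7 {p : ℝ} (hp : p ∈ Set.Ioo (0 : ℝ) 1) :
    Tendsto (fun i : ℕ =>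
      ∑ k ∈ Finset.Icc 1 (nseq1 p i), ∑ l ∈ Finset.Icc 1 (nseq1 p i),
        ∑ m ∈ Finset.Icc 1 (nseq1 p i),
          if k + l + m ≤ nseq1 p i then expX (nseq1 p i) p k l m else 0)
      atTop (nhds 0) := by
  obtain ⟨h0, h1⟩ := hp
  have hq : 0 < 1 - p := by linarith
  set L := -Real.log (1 - p) with hLdef
  have hL : 0 < L := by
    rw [hLdef, neg_pos]
    exact Real.log_neg hq (by linarith)
  have hexp : Real.exp (-L) = 1 - p := by rw [hLdef, neg_neg, Real.exp_log hq]
  have hseq : ∀ i : ℕ, nseq1 p i = Nat.floor (Real.exp (L * (i + 1 / 2)) * i) := by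
    intro i
    rw [nseq1, Real.rpow_def_of_pos (by positivity), one_div, Real.log_inv]
  have hn : ∀ i : ℕ, (nseq1 p i : ℝ) ≤ Real.exp (L * (i + 1 / 2)) * i := fun i => by
    rw [hseq]
    exact Nat.floor_le (by positivity)
  have hn' : ∀ i : ℕ, Real.exp (L * (i + 1 / 2)) * i < nseq1 p i + 1 := fun i => by
    rw [hseq]
    exact Nat.lt_floor_add_one _
  obtain ⟨c, hc, hψ⟩ := exists_mul_abs_le_exp_neg_sub (half_pos hL)
  set ε := min (c / 12) (1 / 16) with hεdef
  have hε : 0 < ε := lt_min (by positivity) (by norm_num)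
  have hεc : 12 * ε ≤ c := by linarith [min_le_left (c / 12) (1 / 16 : ℝ)]
  have hε16 : ε ≤ 1 / 16 := min_le_right _ _
  have hlim := (tendsto_tailBound hL hε hn).add (tendsto_windowBound hL hc)
  rw [add_zero] at hlim
  have hεi : ∀ᶠ i : ℕ in atTop, 1 / 2 ≤ ε * i :=
    (tendsto_natCast_atTop_atTop.const_mul_atTop hε).eventually_ge_atTop _
  have herr : ∀ᶠ i : ℕ in atTop,
      3 * (1 + 12 * (i : ℝ)) * Real.exp (-(L * ((1 - ε) * i))) ≤ 1 := by
    have hδ : 0 < L * (1 - ε) := mul_pos hL (by linarith)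
    have h := ((tendsto_pow_mul_exp_neg_mul_nat hδ 0).const_mul 3).add
      ((tendsto_pow_mul_exp_neg_mul_nat hδ 1).const_mul 36)
    simp only [mul_zero, add_zero] at h
    filter_upwards [h.eventually_le_const one_pos] with i hi
    refine le_trans (le_of_eq ?_) hi
    rw [mul_assoc L]
    ring
  refine squeeze_zero' (Eventually.of_forall fun i => ?_) ?_ hlim
  · refine Finset.sum_nonneg fun k _ => Finset.sum_nonneg fun l _ => Finset.sum_nonneg fun m _ => ?_
    split_ifs
    · exact integral_nonneg fun G => Nat.cast_nonneg _
    · exact le_rfl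
  · filter_upwards [hεi, herr] with i hεi herr
    have hw : 0 ≤ windowBound L c i := mul_nonneg (by positivity) (Real.exp_pos _).le
    refine (sum_Icc_triple_le _ (4 * i) _ (a := tailBound L ε (nseq1 p i) i) hw ?_).trans
      (le_of_eq (by push_cast; rfl))
    intro k hk l hl m hm
    rw [Finset.mem_Icc] at hk hl hm
    by_cases h : k + l + m ≤ nseq1 p i
    · rw [if_pos h]
      have hX := expX_le_tripleBound h0.le h1 hk.1 hl.1 hm.1 h
      rw [← hexp] at hX
      exact hX.trans (tripleBound_le hL hc hψ hε hεc hε16 hεi herr (hn i) (hn' i) h hk.1 hl.1 hm.1)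
    · rw [if_neg h]
      refine add_nonneg ?_ ?_
      · rw [tailBound]
        positivity
      · split_ifs
        exacts [hw, le_rfl]
end
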